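/- arXiv:2005.03265 — 8 statements merged into one kernel-verified Lean document; each statement's English description precedes it below -/
import Mathlib

section
/- Let f : ℝ → (-∞, +∞] be a proper, closed, convex function with [α, β] ⊆ dom f, let τ > 0, and let x ∈ L¹([0,τ]) satisfy x(s) ∈ [α, β] for almost every s ∈ [0,τ] and Ax = b. Suppose there exist 0 ≤ ζ₁ < ζ₂ ≤ τ and ε₁ ≤ ε₂ with [ε₁, ε₂] ⊂ (α, β) such that x(s) ∈ [ε₁, ε₂] for almost every s ∈ [ζ₁, ζ₂], and suppose the functions a₁, …, aₙ are bounded on [ζ₁, ζ₂] and linearly independent as elements of L^∞([ζ₁, ζ₂]). Then b lies in the core of A(dom I_f): for every direction η ∈ ℝⁿ there exists t > 0 such that b + tη ∈ A(dom I_f). -/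
open MeasureTheory Set
open scoped ENNReal NNReal

/-- The nonnegative part of an extended real number, as an element of `[0,∞]`. -/
noncomputable def erealToENNReal (x : EReal) : ℝ≥0∞ :=
  if x = ⊤ then ⊤ else ENNReal.ofReal x.toReal

/-- The extended-real-valued integral of an extended-real-valued function:
the integral of the positive part minus the integral of the negative part. -/
noncomputable def eintegral {α : Type*} [MeasurableSpace α] (μ : Measure α)
    (F : α → EReal) : EReal :=
  ((∫⁻ a, erealToENNReal (F a) ∂μ : ℝ≥0∞) : EReal) -
    ((∫⁻ a, erealToENNReal (-(F a)) ∂μ : ℝ≥0∞) : EReal)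

/-- Convexity of a function `f : ℝ → (-∞,∞]`. -/
def ERealConvexOnReal (f : ℝ → EReal) : Prop :=
  ∀ u v a b : ℝ, 0 ≤ a → 0 ≤ b → a + b = 1 →
    f (a * u + b * v) ≤ (a : EReal) * f u + (b : EReal) * f v

/-- The linear operator `A : L¹([0,τ]) → ℝⁿ`,
`A x = (∫₀^τ a₁ x, …, ∫₀^τ aₙ x)`. -/
noncomputable def entOp (τ : ℝ) {n : ℕ} (a : Fin n → ℝ → ℝ) (x : ℝ → ℝ) : Fin n → ℝ :=
  fun i => ∫ s in Set.Icc (0 : ℝ) τ, a i s * x s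

/-- The core of a set `C ⊆ ℝⁿ`: the points `x ∈ C` such that for every direction `η`,
`x + tη ∈ C` for all sufficiently small `t > 0`. -/
def core {n : ℕ} (C : Set (Fin n → ℝ)) : Set (Fin n → ℝ) :=
  {x ∈ C | ∀ η : Fin n → ℝ, ∃ t₀ > (0 : ℝ), ∀ t : ℝ, 0 < t → t ≤ t₀ → x + t • η ∈ C}

/-- The domain of the entropy functional `I_f` on `L¹([0,τ])`:
integrable functions `x` with `∫₀^τ f(x(s)) ds < ∞`. -/
noncomputable def domIf (f : ℝ → EReal) (τ : ℝ) : Set (ℝ → ℝ) :=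
  {x | IntegrableOn x (Set.Icc 0 τ) ∧
       eintegral (volume.restrict (Set.Icc 0 τ)) (fun s => f (x s)) < ⊤}

theorem mem_domIf_of_bdd (f : ℝ → EReal)
    (hbot : ∀ u : ℝ, f u ≠ ⊥) (hconv : ERealConvexOnReal f)
    (α β : ℝ) (hαβ : α < β) (hdom : ∀ u ∈ Set.Icc α β, f u < ⊤)
    (τ : ℝ) (y : ℝ → ℝ) (hy : IntegrableOn y (Set.Icc 0 τ))
    (hyab : ∀ᵐ s ∂(volume.restrict (Set.Icc 0 τ)), y s ∈ Set.Icc α β) :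
    y ∈ domIf f τ := by
  refine ⟨hy, ?_⟩
  obtain ⟨p, hp⟩ : ∃ p : ℝ, f α = p :=
    ⟨(f α).toReal, (EReal.coe_toReal (hdom α ⟨le_rfl, hαβ.le⟩).ne (hbot α)).symm⟩
  obtain ⟨q, hq⟩ : ∃ q : ℝ, f β = q :=
    ⟨(f β).toReal, (EReal.coe_toReal (hdom β ⟨hαβ.le, le_rfl⟩).ne (hbot β)).symm⟩
  have key : ∀ u ∈ Set.Icc α β, erealToENNReal (f u) ≤ ENNReal.ofReal (max p q) := by
    intro u hu
    obtain ⟨r, hr⟩ : ∃ r : ℝ, f u = r :=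
      ⟨(f u).toReal, (EReal.coe_toReal (hdom u hu).ne (hbot u)).symm⟩
    have hpos : 0 < β - α := sub_pos.2 hαβ
    have h1 : 0 ≤ (β - u) / (β - α) := div_nonneg (by linarith [hu.2]) hpos.le
    have h2 : 0 ≤ (u - α) / (β - α) := div_nonneg (by linarith [hu.1]) hpos.le
    have h3 : (β - u) / (β - α) + (u - α) / (β - α) = 1 := by
      field_simp; ring
    have h4 : (β - u) / (β - α) * α + (u - α) / (β - α) * β = u := by
      field_simp; ring
    have h := hconv α β _ _ h1 h2 h3
    rw [h4, hp, hq, hr] at h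
    have h' : r ≤ (β - u) / (β - α) * p + (u - α) / (β - α) * q := by exact_mod_cast h
    have h5 : r ≤ max p q := by
      have e1 := mul_le_mul_of_nonneg_left (le_max_left p q) h1
      have e2 := mul_le_mul_of_nonneg_left (le_max_right p q) h2
      have e3 : (β - u) / (β - α) * max p q + (u - α) / (β - α) * max p q = max p q := by
        rw [← add_mul, h3, one_mul]
      linarith
    rw [hr]
    simp only [erealToENNReal, EReal.coe_ne_top, if_false, EReal.toReal_coe]
    exact ENNReal.ofReal_le_ofReal h5
  have hfin : (∫⁻ s in Set.Icc 0 τ, erealToENNReal (f (y s))) < ⊤ := by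
    calc (∫⁻ s in Set.Icc 0 τ, erealToENNReal (f (y s)))
        ≤ ∫⁻ s in Set.Icc 0 τ, ENNReal.ofReal (max p q) :=
          lintegral_mono_ae (hyab.mono fun s hs => key _ hs)
      _ < ⊤ := by
          rw [lintegral_const]
          exact ENNReal.mul_lt_top ENNReal.ofReal_lt_top (by simp)
  unfold eintegral
  refine lt_of_le_of_lt (EReal.sub_le_sub le_rfl (EReal.coe_ennreal_nonneg _)) ?_
  rw [sub_zero]
  exact lt_top_iff_ne_top.2 (by simpa using hfin.ne)

theorem gram_surj {n : ℕ} (a : Fin n → ℝ → ℝ) (μ : Measure ℝ)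
    (haa : ∀ i j, Integrable (fun s => a i s * a j s) μ)
    (hli : ∀ l : Fin n → ℝ, (∀ᵐ s ∂μ, ∑ i, l i * a i s = 0) → l = 0)
    (η : Fin n → ℝ) :
    ∃ c : Fin n → ℝ, ∀ i, ∫ s, a i s * ∑ j, c j * a j s ∂μ = η i := by
  let G : Matrix (Fin n) (Fin n) ℝ := fun i j => ∫ s, a i s * a j s ∂μ
  have hG : ∀ c i, (G.mulVecLin c) i = ∫ s, a i s * ∑ j, c j * a j s ∂μ := by
    intro c i
    have : ∀ s, a i s * ∑ j, c j * a j s = ∑ j, (a i s * a j s) * c j := by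
      intro s
      rw [Finset.mul_sum]
      exact Finset.sum_congr rfl fun j _ => by ring
    simp_rw [this]
    rw [integral_finsetSum _ fun j _ => (haa i j).mul_const _]
    simp_rw [integral_mul_const]
    rfl
  have hint : ∀ (c : Fin n → ℝ) i, Integrable (fun s => a i s * ∑ j, c j * a j s) μ := by
    intro c i
    have : (fun s => a i s * ∑ j, c j * a j s) = fun s => ∑ j, (a i s * a j s) * c j := by
      funext s
      rw [Finset.mul_sum]
      exact Finset.sum_congr rfl fun j _ => by ring
    rw [this]
    exact integrable_finsetSum _ fun j _ => (haa i j).mul_const _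
  have hinj : Function.Injective G.mulVecLin := by
    rw [← LinearMap.ker_eq_bot, LinearMap.ker_eq_bot']
    intro c hc
    apply hli
    have hsq : (fun s => (∑ j, c j * a j s) ^ 2)
        = fun s => ∑ i, c i * (a i s * ∑ j, c j * a j s) := by
      funext s
      rw [sq, Finset.sum_mul]
      exact Finset.sum_congr rfl fun j _ => by ring
    have hi : Integrable (fun s => (∑ j, c j * a j s) ^ 2) μ := by
      rw [hsq]
      exact integrable_finsetSum _ fun j _ => (hint c j).const_mul _
    have h0 : ∫ s, (∑ j, c j * a j s) ^ 2 ∂μ = 0 := by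
      rw [hsq, integral_finsetSum _ fun j _ => (hint c j).const_mul _]
      refine Finset.sum_eq_zero fun i _ => ?_
      rw [integral_const_mul, ← hG, hc]
      simp
    have h1 := (integral_eq_zero_iff_of_nonneg (fun s => sq_nonneg _) hi).1 h0
    filter_upwards [h1] with s hs
    exact pow_eq_zero_iff (two_ne_zero) |>.1 hs
  obtain ⟨c, hc⟩ := (LinearMap.injective_iff_surjective.1 hinj) η
  exact ⟨c, fun i => by rw [← hG, hc]⟩

/-- **Theorem** (`thm:main`). Let `f` be proper, closed and convex with `[α,β] ⊆ dom f`,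
let `x ∈ L¹([0,τ])` be feasible (`x(s) ∈ [α,β]` a.e. and `Ax = b`), suppose
`x(s) ∈ [ε₁,ε₂] ⊆ (α,β)` a.e. on some `[ζ₁,ζ₂] ⊆ [0,τ]` with `ζ₁ < ζ₂`, and suppose
`a₁,…,aₙ` are bounded on `[ζ₁,ζ₂]` and linearly independent in `L^∞([ζ₁,ζ₂])`.
Then `b ∈ core (A (dom I_f))`. -/
theorem stmt_0 (f : ℝ → EReal)
    (hbot : ∀ u : ℝ, f u ≠ ⊥) (hproper : ∃ u : ℝ, f u ≠ ⊤)
    (hclosed : LowerSemicontinuous f) (hconv : ERealConvexOnReal f)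
    (α β : ℝ) (hdom : ∀ u ∈ Set.Icc α β, f u < ⊤)
    (τ : ℝ) (hτ : 0 < τ)
    {n : ℕ} (a : Fin n → ℝ → ℝ)
    (haL : ∀ i, MemLp (a i) ⊤ (volume.restrict (Set.Icc 0 τ)))
    (x : ℝ → ℝ) (hx : IntegrableOn x (Set.Icc 0 τ))
    (hxab : ∀ᵐ s ∂(volume.restrict (Set.Icc 0 τ)), x s ∈ Set.Icc α β)
    (b : Fin n → ℝ) (hAxb : entOp τ a x = b)
    (ζ₁ ζ₂ : ℝ) (hζ₁ : 0 ≤ ζ₁) (hζ : ζ₁ < ζ₂) (hζ₂ : ζ₂ ≤ τ)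
    (ε₁ ε₂ : ℝ) (hε : ε₁ ≤ ε₂) (hεαβ : Set.Icc ε₁ ε₂ ⊆ Set.Ioo α β)
    (hxε : ∀ᵐ s ∂(volume.restrict (Set.Icc ζ₁ ζ₂)), x s ∈ Set.Icc ε₁ ε₂)
    (habd : ∀ i, ∃ C : ℝ, ∀ s ∈ Set.Icc ζ₁ ζ₂, |a i s| ≤ C)
    (hli : ∀ l : Fin n → ℝ,
      (∀ᵐ s ∂(volume.restrict (Set.Icc ζ₁ ζ₂)), ∑ i, l i * a i s = 0) → l = 0) :
    b ∈ core (entOp τ a '' domIf f τ) := by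
  have hε₁ := hεαβ ⟨le_rfl, hε⟩
  have hε₂ := hεαβ ⟨hε, le_rfl⟩
  have hαβ : α < β := hε₁.1.trans hε₁.2
  have hsub : Set.Icc ζ₁ ζ₂ ⊆ Set.Icc 0 τ := Set.Icc_subset_Icc hζ₁ hζ₂
  refine ⟨⟨x, mem_domIf_of_bdd f hbot hconv α β hαβ hdom τ x hx hxab, hAxb⟩, fun η => ?_⟩
  have haI : ∀ (i) (g : ℝ → ℝ), IntegrableOn g (Set.Icc 0 τ) →
      IntegrableOn (fun s => a i s * g s) (Set.Icc 0 τ) := by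
    intro i g hg
    exact Integrable.mul_of_top_right hg (haL i)
  have ha1 : ∀ i, IntegrableOn (a i) (Set.Icc 0 τ) := fun i => (haL i).integrable le_top
  obtain ⟨c, hc⟩ := gram_surj a (volume.restrict (Set.Icc ζ₁ ζ₂))
    (fun i j => (haI i _ (ha1 j)).mono_set hsub) hli η
  choose C hC using habd
  let g : ℝ → ℝ := fun s => ∑ j, c j * a j s
  let h : ℝ → ℝ := (Set.Icc ζ₁ ζ₂).indicator g
  have hgI : IntegrableOn g (Set.Icc 0 τ) :=
    integrable_finsetSum _ fun j _ => (ha1 j).const_mul _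
  have hhI : IntegrableOn h (Set.Icc 0 τ) := hgI.indicator measurableSet_Icc
  let M : ℝ := ∑ j, |c j| * |C j| + 1
  have hM : 0 < M := by
    have : 0 ≤ ∑ j, |c j| * |C j| := Finset.sum_nonneg fun j _ => by positivity
    simp only [M]; linarith
  have hgM : ∀ s ∈ Set.Icc ζ₁ ζ₂, |g s| ≤ M := by
    intro s hs
    have : |g s| ≤ ∑ j, |c j| * |C j| := by
      refine (Finset.abs_sum_le_sum_abs _ _).trans (Finset.sum_le_sum fun j _ => ?_)
      rw [abs_mul]
      exact mul_le_mul_of_nonneg_left ((hC j s hs).trans (le_abs_self _)) (abs_nonneg _)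
    simp only [M]; linarith
  let d : ℝ := min (ε₁ - α) (β - ε₂)
  have hd : 0 < d := lt_min (sub_pos.2 hε₁.1) (sub_pos.2 hε₂.2)
  refine ⟨d / M, div_pos hd hM, fun t ht htd => ?_⟩
  have htM : t * M ≤ d := (le_div_iff₀ hM).1 htd
  refine ⟨fun s => x s + t * h s, mem_domIf_of_bdd f hbot hconv α β hαβ hdom τ _
    (hx.add (hhI.const_mul t)) ?_, ?_⟩
  · have hxε' := (ae_restrict_iff' measurableSet_Icc).1 hxε
    filter_upwards [hxab, ae_restrict_of_ae hxε'] with s hs1 hs2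
    by_cases hs : s ∈ Set.Icc ζ₁ ζ₂
    · have e1 : h s = g s := Set.indicator_of_mem hs g
      have e2 := hs2 hs
      have e3 : |t * g s| ≤ d := by
        rw [abs_mul, abs_of_pos ht]
        exact (mul_le_mul_of_nonneg_left (hgM s hs) ht.le).trans htM
      have e4 := abs_le.1 e3
      have e5 : d ≤ ε₁ - α := min_le_left _ _
      have e6 : d ≤ β - ε₂ := min_le_right _ _
      rw [e1]
      exact ⟨by linarith [e2.1, e4.1], by linarith [e2.2, e4.2]⟩
    · have e1 : h s = 0 := Set.indicator_of_notMem hs g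
      rw [e1, mul_zero, add_zero]
      exact hs1
  · funext i
    rw [← hAxb]
    simp only [entOp, Pi.add_apply, Pi.smul_apply, smul_eq_mul]
    have e : ∀ s, a i s * (x s + t * h s) = a i s * x s + t * (a i s * h s) := fun s => by ring
    simp_rw [e]
    rw [integral_add (haI i x hx) ((haI i h hhI).const_mul t), integral_const_mul]
    congr 2
    rw [← hc i]
    have e' : (fun s => a i s * h s) = (Set.Icc ζ₁ ζ₂).indicator (fun s => a i s * g s) := by
      funext s
      by_cases hs : s ∈ Set.Icc ζ₁ ζ₂ <;> simp [h, hs]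
    rw [e', setIntegral_indicator measurableSet_Icc, Set.inter_eq_self_of_subset_right hsub]
end

section
/- Let f : ℝ → (-∞, +∞] be a proper, closed, convex function with [α, β] ⊆ dom f, let τ > 0, and let a₁, …, aₙ ∈ L^∞([0,τ]) be linearly independent. Suppose y ∈ L¹([0,τ]) satisfies Ay = b and α < y(s) < β for almost every s ∈ [0,τ]. Then b lies in the core of A(dom I_f). -/
open MeasureTheory Set
open scoped ENNReal NNReal

lemma aux_bound (f : ℝ → EReal) (hbot : ∀ u : ℝ, f u ≠ ⊥) (hconv : ERealConvexOnReal f)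
    (α β : ℝ) (hdom : ∀ u ∈ Set.Icc α β, f u < ⊤) :
    ∃ M : ℝ, ∀ u ∈ Set.Icc α β, f u ≤ (M : EReal) := by
  rcases lt_trichotomy α β with h | h | h
  · have h1 := hdom α ⟨le_rfl, h.le⟩
    have h2 := hdom β ⟨h.le, le_rfl⟩
    obtain ⟨p, hp⟩ : ∃ p : ℝ, f α = p := ⟨_, (EReal.coe_toReal h1.ne (hbot α)).symm⟩
    obtain ⟨q, hq⟩ : ∃ q : ℝ, f β = q := ⟨_, (EReal.coe_toReal h2.ne (hbot β)).symm⟩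
    refine ⟨max p q, fun u hu => ?_⟩
    have hd : 0 < β - α := sub_pos.2 h
    have ha : 0 ≤ (β - u) / (β - α) := div_nonneg (sub_nonneg.2 hu.2) hd.le
    have hb : 0 ≤ (u - α) / (β - α) := div_nonneg (sub_nonneg.2 hu.1) hd.le
    have hab : (β - u) / (β - α) + (u - α) / (β - α) = 1 := by
      field_simp
      ring
    have := hconv α β _ _ ha hb hab
    have hu' : (β - u) / (β - α) * α + (u - α) / (β - α) * β = u := by
      field_simp
      ring
    rw [hu', hp, hq] at this
    refine this.trans ?_
    norm_cast
    have e1 := mul_le_mul_of_nonneg_left (le_max_left p q) ha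
    have e2 := mul_le_mul_of_nonneg_left (le_max_right p q) hb
    have e3 : (β - u) / (β - α) * max p q + (u - α) / (β - α) * max p q = max p q := by
      rw [← add_mul, hab, one_mul]
    linarith
  · subst h
    refine ⟨(f α).toReal, fun u hu => ?_⟩
    have : u = α := le_antisymm hu.2 hu.1
    subst this
    rw [EReal.coe_toReal (hdom u hu).ne (hbot u)]
  · exact ⟨0, fun u hu => absurd (hu.1.trans hu.2) (not_le.2 h)⟩

lemma aux_dom (f : ℝ → EReal) (hbot : ∀ u : ℝ, f u ≠ ⊥) (hconv : ERealConvexOnReal f)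
    (α β : ℝ) (hdom : ∀ u ∈ Set.Icc α β, f u < ⊤) (τ : ℝ) (x : ℝ → ℝ)
    (hx : IntegrableOn x (Set.Icc 0 τ))
    (hxab : ∀ᵐ s ∂(volume.restrict (Set.Icc 0 τ)), x s ∈ Set.Icc α β) :
    x ∈ domIf f τ := by
  obtain ⟨M, hM⟩ := aux_bound f hbot hconv α β hdom
  refine ⟨hx, ?_⟩
  have h1 : ∫⁻ s, erealToENNReal (f (x s)) ∂(volume.restrict (Set.Icc 0 τ)) < ⊤ := by
    calc _ ≤ ∫⁻ s, ENNReal.ofReal M ∂(volume.restrict (Set.Icc 0 τ)) := by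
          refine lintegral_mono_ae ?_
          filter_upwards [hxab] with s hs
          have h2 := hM _ hs
          have h3 := (hdom _ hs).ne
          rw [erealToENNReal, if_neg h3]
          apply ENNReal.ofReal_le_ofReal
          rw [← EReal.coe_toReal h3 (hbot _)] at h2
          exact_mod_cast h2
      _ < ⊤ := by
          rw [lintegral_const]
          exact ENNReal.mul_lt_top ENNReal.ofReal_lt_top (measure_lt_top _ _)
  unfold eintegral
  refine lt_of_le_of_lt (b := ((∫⁻ s, erealToENNReal (f (x s)) ∂(volume.restrict (Set.Icc 0 τ)) : ℝ≥0∞) : EReal)) ?_ ?_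
  · rw [sub_eq_add_neg]
    refine (add_le_add_right (b := -_) (c := 0) ?_ _).trans (add_zero _).le
    rw [EReal.neg_le, neg_zero]
    exact EReal.coe_ennreal_nonneg _
  · rw [lt_top_iff_ne_top]
    simpa using h1.ne

/-- **Theorem** (`thm:qri`). Let `f` be proper, closed and convex with `[α,β] ⊆ dom f`,
and let `a₁,…,aₙ ∈ L^∞([0,τ])` be linearly independent. If `y ∈ L¹([0,τ])` satisfies
`Ay = b` and `α < y(s) < β` a.e., then `b ∈ core (A (dom I_f))`. -/
theorem stmt_3 (f : ℝ → EReal)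
    (hbot : ∀ u : ℝ, f u ≠ ⊥) (hproper : ∃ u : ℝ, f u ≠ ⊤)
    (hclosed : LowerSemicontinuous f) (hconv : ERealConvexOnReal f)
    (α β : ℝ) (hdom : ∀ u ∈ Set.Icc α β, f u < ⊤)
    (τ : ℝ) (hτ : 0 < τ)
    {n : ℕ} (a : Fin n → ℝ → ℝ)
    (haL : ∀ i, MemLp (a i) ⊤ (volume.restrict (Set.Icc 0 τ)))
    (hli : ∀ l : Fin n → ℝ,
      (∀ᵐ s ∂(volume.restrict (Set.Icc 0 τ)), ∑ i, l i * a i s = 0) → l = 0)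
    (y : ℝ → ℝ) (hy : IntegrableOn y (Set.Icc 0 τ))
    (b : Fin n → ℝ) (hAyb : entOp τ a y = b)
    (hyab : ∀ᵐ s ∂(volume.restrict (Set.Icc 0 τ)), α < y s ∧ y s < β) :
    b ∈ core (entOp τ a '' domIf f τ) := by
  set μ := volume.restrict (Set.Icc (0:ℝ) τ) with hμ
  have hy' : Integrable y μ := hy
  let w : ℝ → ℝ := fun s => min (y s - α) (β - y s)
  have hw : Integrable w μ :=
    (hy'.sub (integrable_const α)).inf ((integrable_const β).sub hy')
  have hwpos : ∀ᵐ s ∂μ, 0 < w s := by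
    filter_upwards [hyab] with s hs
    exact lt_min (sub_pos.2 hs.1) (sub_pos.2 hs.2)
  let S : (Fin n → ℝ) → ℝ → ℝ := fun l s => ∑ j, l j * a j s
  have hS : ∀ l, MemLp (S l) ⊤ μ := fun l =>
    memLp_finsetSum (p := ⊤) Finset.univ (fun j _ => (haL j).const_mul (l j))
  have hmul : ∀ (g p : ℝ → ℝ), Integrable g μ → MemLp p ⊤ μ →
      Integrable (fun s => p s * g s) μ := fun g p hg hp => hg.mul_of_top_right hp
  have hwS : ∀ l, Integrable (fun s => w s * S l s) μ := fun l => by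
    simpa only [mul_comm] using hmul w (S l) hw (hS l)
  let T : (Fin n → ℝ) →ₗ[ℝ] (Fin n → ℝ) :=
    { toFun := fun l i => ∫ s, a i s * (w s * S l s) ∂μ
      map_add' := by
        intro l m
        ext i
        simp only [Pi.add_apply]
        rw [← integral_add (hmul _ _ (hwS l) (haL i)) (hmul _ _ (hwS m) (haL i))]
        congr 1
        ext s
        simp only [S, Pi.add_apply, add_mul, Finset.sum_add_distrib]
        ring
      map_smul' := by
        intro c l
        ext i
        simp only [Pi.smul_apply, smul_eq_mul, RingHom.id_apply]
        rw [← integral_const_mul]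
        congr 1
        ext s
        simp only [S, Pi.smul_apply, smul_eq_mul, mul_assoc, ← Finset.mul_sum]
        ring }
  have hTapp : ∀ l i, T l i = ∫ s, a i s * (w s * S l s) ∂μ := fun l i => rfl
  have hinj : Function.Injective T := by
    rw [← LinearMap.ker_eq_bot, LinearMap.ker_eq_bot']
    intro l hl
    apply hli
    have h0 : ∑ i, l i * T l i = 0 := by simp [hl]
    have h1 : ∑ i, l i * T l i = ∫ s, S l s * (w s * S l s) ∂μ := by
      simp only [hTapp, ← integral_const_mul]
      rw [← integral_finsetSum]
      · congr 1
        ext s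
        simp only [← mul_assoc, ← Finset.sum_mul, S]
      · intro i _
        exact (hmul _ _ (hwS l) (haL i)).const_mul _
    rw [h0] at h1
    have hnn : 0 ≤ᵐ[μ] fun s => S l s * (w s * S l s) := by
      filter_upwards [hwpos] with s hs
      have : S l s * (w s * S l s) = w s * (S l s) ^ 2 := by ring
      simp only [Pi.zero_apply, this]
      positivity
    have h2 := (integral_eq_zero_iff_of_nonneg_ae hnn (hmul _ _ (hwS l) (hS l))).1 h1.symm
    filter_upwards [h2, hwpos] with s hs hp
    have h3 : S l s * (w s * S l s) = 0 := hs
    rcases mul_eq_zero.1 h3 with h | h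
    · exact h
    · exact (mul_eq_zero.1 h).resolve_left hp.ne'
  have hsurj : Function.Surjective T := LinearMap.injective_iff_surjective.1 hinj
  refine ⟨⟨y, ?_, hAyb⟩, fun η => ?_⟩
  · refine aux_dom f hbot hconv α β hdom τ y hy ?_
    filter_upwards [hyab] with s hs
    exact ⟨hs.1.le, hs.2.le⟩
  · obtain ⟨l, hl⟩ := hsurj η
    obtain ⟨C, hC⟩ : ∃ C : ℝ, ∀ᵐ s ∂μ, |S l s| ≤ C := by
      refine ⟨(eLpNormEssSup (S l) μ).toReal, ?_⟩
      have hfin : eLpNormEssSup (S l) μ ≠ ⊤ := by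
        have := (hS l).2.ne
        rwa [eLpNorm_exponent_top] at this
      filter_upwards [ae_le_eLpNormEssSup (f := S l) (μ := μ)] with s hs
      have := ENNReal.toReal_mono hfin hs
      simpa using this
    refine ⟨1 / (|C| + 1), by positivity, fun t ht htC => ?_⟩
    have hxint : Integrable (fun s => y s + t * (w s * S l s)) μ :=
      hy'.add ((hwS l).const_mul t)
    refine ⟨fun s => y s + t * (w s * S l s), ?_, ?_⟩
    · refine aux_dom f hbot hconv α β hdom τ _ hxint ?_
      filter_upwards [hC, hwpos] with s hs hp
      have h1 : |t * S l s| ≤ 1 := by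
        rw [abs_mul, abs_of_pos ht]
        rw [le_div_iff₀ (by positivity)] at htC
        have h5 : |S l s| ≤ |C| + 1 := by linarith [le_abs_self C]
        exact (mul_le_mul_of_nonneg_left h5 ht.le).trans htC
      have h2 : w s ≤ y s - α := min_le_left _ _
      have h3 : w s ≤ β - y s := min_le_right _ _
      have h4 := abs_le.1 h1
      have e : t * (w s * S l s) = w s * (t * S l s) := by ring
      simp only [e]
      constructor <;> nlinarith [h4.1, h4.2]
    · ext i
      have hb : b i = ∫ s, a i s * y s ∂μ := by rw [← hAyb]; rfl
      have hη : η i = ∫ s, a i s * (w s * S l s) ∂μ := by rw [← hl]; rfl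
      simp only [Pi.add_apply, Pi.smul_apply, smul_eq_mul, entOp]
      rw [hb, hη, ← integral_const_mul, ← integral_add (hmul _ _ hy' (haL i))
        ((hmul _ _ (hwS l) (haL i)).const_mul t)]
      congr 1
      ext s
      ring
end

section
/- Let (T, μ) be a finite measure space, let 1 ≤ p ≤ ∞ with conjugate exponent q, let α < β, and let x ∈ L^p(T) satisfy α ≤ x(t) ≤ β almost everywhere with μ({t : α < x(t) < β}) > 0. Suppose a₁, …, aₙ ∈ L^q(T) are pseudo-Haar. Then there exist y ∈ L^∞(T) and ε > 0 with α + ε ≤ y(t) ≤ β − ε almost everywhere and ∫_T x a_i dμ = ∫_T y a_i dμ for each i = 1, …, n. -/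
open MeasureTheory Set
open scoped ENNReal NNReal

/-- **Theorem** (`thm:2sided`, extension of Borwein–Lewis). Let `(T,μ)` be a finite
measure space, `p` and `q` conjugate exponents, `x ∈ L^p(T)` with `α ≤ x ≤ β` a.e.
and `μ({α < x < β}) > 0`, and let `a₁,…,aₙ ∈ L^q(T)` be pseudo-Haar. Then there exist
`y ∈ L^∞(T)` and `ε > 0` with `α + ε ≤ y ≤ β − ε` a.e. and `∫ x aᵢ = ∫ y aᵢ` for each `i`. -/
theorem stmt_4 {T : Type*} [MeasurableSpace T] (μ : Measure T) [IsFiniteMeasure μ]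
    {n : ℕ} (p q : ℝ≥0∞) (hpq : p.HolderConjugate q)
    (α β : ℝ) (hαβ : α < β)
    (x : T → ℝ) (hx : MemLp x p μ)
    (hxab : ∀ᵐ t ∂μ, x t ∈ Set.Icc α β)
    (hpos : 0 < μ {t | α < x t ∧ x t < β})
    (a : Fin n → T → ℝ) (ha : ∀ i, MemLp (a i) q μ)
    (hph : ∀ S : Set T, MeasurableSet S → μ S ≠ 0 → ∀ l : Fin n → ℝ,
      (∀ᵐ t ∂(μ.restrict S), ∑ i, l i * a i t = 0) → l = 0) :
    ∃ y : T → ℝ, ∃ ε > (0 : ℝ), MemLp y ⊤ μ ∧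
      (∀ᵐ t ∂μ, y t ∈ Set.Icc (α + ε) (β - ε)) ∧
      ∀ i, ∫ t, x t * a i t ∂μ = ∫ t, y t * a i t ∂μ := by
  classical
  have hq1 : 1 ≤ q := hpq.symm.one_le
  have hai : ∀ i, Integrable (a i) μ := fun i => (ha i).integrable hq1
  set x' : T → ℝ := hx.1.mk x with hx'
  have hx'm : Measurable x' := hx.1.stronglyMeasurable_mk.measurable
  have hxx' : x =ᵐ[μ] x' := hx.1.ae_eq_mk
  let a' : Fin n → T → ℝ := fun i => (ha i).1.mk (a i)
  have ha'm : ∀ i, Measurable (a' i) := fun i => (ha i).1.stronglyMeasurable_mk.measurable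
  have haa' : ∀ᵐ t ∂μ, ∀ i, a i t = a' i t := by
    rw [ae_all_iff]
    exact fun i => (ha i).1.ae_eq_mk
  let Sk : ℕ → Set T := fun k => {t | α + 1 / ((k : ℝ) + 1) ≤ x' t} ∩
    {t | x' t ≤ β - 1 / ((k : ℝ) + 1)} ∩ ⋂ i, {t | |a' i t| ≤ (k : ℝ)}
  have hSkm : ∀ k, MeasurableSet (Sk k) := by
    intro k
    refine ((measurableSet_le measurable_const hx'm).inter
      (measurableSet_le hx'm measurable_const)).inter (MeasurableSet.iInter fun i => ?_)
    exact measurableSet_le (ha'm i).abs measurable_const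
  have hex : ∃ k, μ (Sk k) ≠ 0 := by
    by_contra! h
    have h1 : μ (⋃ k, Sk k) = 0 := measure_iUnion_null h
    have h2 : ∀ᵐ t ∂μ, t ∉ ⋃ k, Sk k := measure_eq_zero_iff_ae_notMem.1 h1
    have h3 : μ {t | α < x t ∧ x t < β} = 0 := by
      rw [measure_eq_zero_iff_ae_notMem]
      filter_upwards [h2, hxx'] with t ht hxt hmem
      apply ht
      obtain ⟨hm1, hm2⟩ := hmem
      rw [hxt] at hm1 hm2
      obtain ⟨k1, hk1⟩ := exists_nat_one_div_lt (sub_pos.2 hm1)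
      obtain ⟨k2, hk2⟩ := exists_nat_one_div_lt (sub_pos.2 hm2)
      obtain ⟨k3, hk3⟩ := exists_nat_ge (∑ i, |a' i t|)
      let k := max k1 (max k2 k3)
      have e1 : (1 : ℝ) / ((k : ℝ) + 1) ≤ 1 / ((k1 : ℝ) + 1) :=
        Nat.one_div_le_one_div (le_max_left _ _)
      have e2 : (1 : ℝ) / ((k : ℝ) + 1) ≤ 1 / ((k2 : ℝ) + 1) :=
        Nat.one_div_le_one_div ((le_max_left _ _).trans (le_max_right _ _))
      have e3 : (k3 : ℝ) ≤ (k : ℝ) := by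
        exact_mod_cast (le_max_right k2 k3).trans (le_max_right _ _)
      refine mem_iUnion.2 ⟨k, ⟨?_, ?_⟩, mem_iInter.2 fun i => ?_⟩
      · show α + 1 / ((k : ℝ) + 1) ≤ x' t
        linarith
      · show x' t ≤ β - 1 / ((k : ℝ) + 1)
        linarith
      · show |a' i t| ≤ (k : ℝ)
        have := Finset.single_le_sum (f := fun i => |a' i t|) (fun i _ => abs_nonneg _)
          (Finset.mem_univ i)
        linarith
    exact hpos.ne' h3
  obtain ⟨k, hk⟩ := hex
  set S := Sk k with hS
  have hSm : MeasurableSet S := hSkm k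
  obtain ⟨δ, hδ, hδS⟩ : ∃ δ > (0 : ℝ), ∀ t ∈ S, α + δ ≤ x' t ∧ x' t ≤ β - δ :=
    ⟨1 / ((k : ℝ) + 1), by positivity, fun t ht => ⟨ht.1.1, ht.1.2⟩⟩
  have hMS : ∀ t ∈ S, ∀ i, |a' i t| ≤ (k : ℝ) := fun t ht i => mem_iInter.1 ht.2 i
  let b : Fin n → T → ℝ := fun i => S.indicator (a' i)
  have hbm : ∀ i, Measurable (b i) := fun i => (ha'm i).indicator hSm
  have hbb : ∀ i t, |b i t| ≤ (k : ℝ) := by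
    intro i t
    by_cases ht : t ∈ S
    · simpa [b, ht] using hMS t ht i
    · simp [b, ht]
  have hba : ∀ i j, Integrable (fun t => b j t * a i t) μ := fun i j =>
    (hai i).bdd_mul (c := (k : ℝ)) (hbm j).aestronglyMeasurable
      (Filter.Eventually.of_forall fun t => by simpa using hbb j t)
  let G : Matrix (Fin n) (Fin n) ℝ := fun i j => ∫ t, b j t * a i t ∂μ
  have hGd : ∀ (d : Fin n → ℝ) i, G.mulVec d i = ∫ t, (∑ j, d j * b j t) * a i t ∂μ := by
    intro d i
    have : ∀ t, (∑ j, d j * b j t) * a i t = ∑ j, d j * (b j t * a i t) := by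
      intro t
      rw [Finset.sum_mul]
      exact Finset.sum_congr rfl fun j _ => by ring
    simp only [this]
    rw [integral_finsetSum _ fun j _ => (hba i j).const_mul (d j)]
    simp only [Matrix.mulVec, dotProduct, G, integral_const_mul]
    exact Finset.sum_congr rfl fun j _ => by ring
  have hwa : ∀ (d : Fin n → ℝ) i, Integrable (fun t => (∑ j, d j * b j t) * a i t) μ := by
    intro d i
    have : ∀ t, (∑ j, d j * b j t) * a i t = ∑ j, d j * (b j t * a i t) := by
      intro t
      rw [Finset.sum_mul]
      exact Finset.sum_congr rfl fun j _ => by ring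
    simp only [this]
    exact integrable_finsetSum _ fun j _ => (hba i j).const_mul (d j)
  have hinj : Function.Injective G.mulVecLin := by
    rw [← LinearMap.ker_eq_bot, LinearMap.ker_eq_bot']
    intro l hl
    have h0 : ∀ i, ∫ t, (∑ j, l j * b j t) * a i t ∂μ = 0 := by
      intro i
      rw [← hGd]
      exact congrFun hl i
    have h1 : ∫ t, (∑ i, l i * ((∑ j, l j * b j t) * a i t)) ∂μ = 0 := by
      rw [integral_finsetSum _ fun i _ => (hwa l i).const_mul (l i)]
      simp [integral_const_mul, h0]
    have h1i : Integrable (fun t => ∑ i, l i * ((∑ j, l j * b j t) * a i t)) μ :=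
      integrable_finsetSum _ fun i _ => (hwa l i).const_mul (l i)
    have h2 : ∀ᵐ t ∂μ, ∑ i, l i * ((∑ j, l j * b j t) * a i t)
        = S.indicator (fun t => (∑ i, l i * a i t) ^ 2) t := by
      filter_upwards [haa'] with t ht
      by_cases hts : t ∈ S
      · have : ∀ j, b j t = a j t := fun j => by simp [b, hts, ht]
        simp only [this, indicator_of_mem hts, sq]
        rw [Finset.mul_sum]
        exact Finset.sum_congr rfl fun j _ => by ring
      · simp [b, hts]
    have h3 : 0 ≤ᵐ[μ] fun t => ∑ i, l i * ((∑ j, l j * b j t) * a i t) := by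
      filter_upwards [h2] with t ht
      rw [ht]
      exact indicator_nonneg (fun t _ => sq_nonneg _) t
    have h4 := (integral_eq_zero_iff_of_nonneg_ae h3 h1i).1 h1
    apply hph S hSm hk l
    rw [ae_restrict_iff' hSm]
    filter_upwards [h2, h4] with t ht1 ht2 hts
    rw [ht2, indicator_of_mem hts] at ht1
    exact pow_eq_zero_iff (two_ne_zero) |>.1 ht1.symm
  have hsurj := LinearMap.injective_iff_surjective.1 hinj
  let m : ℝ := (α + β) / 2
  obtain ⟨d, hd⟩ := hsurj (fun i => ∫ t, (x t - m) * a i t ∂μ)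
  let w : T → ℝ := fun t => ∑ j, d j * b j t
  have hwm : Measurable w := Finset.measurable_sum _ fun j _ => (hbm j).const_mul (d j)
  let K : ℝ := ∑ j, |d j| * (k : ℝ)
  have hK0 : 0 ≤ K := Finset.sum_nonneg fun j _ => by positivity
  have hwK : ∀ t, |w t| ≤ K := by
    intro t
    refine (Finset.abs_sum_le_sum_abs _ _).trans (Finset.sum_le_sum fun j _ => ?_)
    rw [abs_mul]
    exact mul_le_mul_of_nonneg_left (hbb j t) (abs_nonneg _)
  have hw0 : ∀ t, t ∉ S → w t = 0 := fun t ht => by simp [w, b, ht]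
  obtain ⟨η, hη0, hη1, hηK⟩ : ∃ η > (0 : ℝ), η ≤ 1 ∧ η * K ≤ δ / 2 := by
    refine ⟨min 1 (δ / (2 * (K + 1))), by positivity, min_le_left _ _, ?_⟩
    calc _ ≤ δ / (2 * (K + 1)) * (K + 1) :=
          mul_le_mul (min_le_right _ _) (by linarith) hK0 (by positivity)
      _ = δ / 2 := by field_simp
  let y : T → ℝ := fun t => x t - η * (x t - m) + η * w t
  let ε : ℝ := min (η * (β - α) / 2) (δ / 2)
  have hε1 : ε ≤ η * (β - α) / 2 := min_le_left _ _
  have hε2 : ε ≤ δ / 2 := min_le_right _ _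
  have hε : 0 < ε := by
    have := sub_pos.2 hαβ
    exact lt_min (by positivity) (by positivity)
  have hyI : ∀ᵐ t ∂μ, y t ∈ Set.Icc (α + ε) (β - ε) := by
    filter_upwards [hxab, hxx'] with t ht hxt
    by_cases hts : t ∈ S
    · obtain ⟨h1, h2⟩ := hδS t hts
      rw [← hxt] at h1 h2
      have h3 := abs_le.1 (hwK t)
      have h4 : η * w t ≤ η * K := mul_le_mul_of_nonneg_left h3.2 hη0.le
      have h5 : η * (-K) ≤ η * w t := mul_le_mul_of_nonneg_left h3.1 hη0.le
      have hm1 : α + δ ≤ m := by simp only [m]; linarith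
      have hm2 : m ≤ β - δ := by simp only [m]; linarith
      have h6 : 0 ≤ (1 - η) * (x t - (α + δ)) := mul_nonneg (by linarith) (by linarith)
      have h7 : 0 ≤ (1 - η) * ((β - δ) - x t) := mul_nonneg (by linarith) (by linarith)
      have h8 : 0 ≤ η * (m - (α + δ)) := mul_nonneg (by linarith) (by linarith)
      have h9 : 0 ≤ η * ((β - δ) - m) := mul_nonneg (by linarith) (by linarith)
      constructor
      · simp only [y]; linarith
      · simp only [y]; linarith
    · have h6 : 0 ≤ (1 - η) * (x t - α) := mul_nonneg (by linarith) (by linarith [ht.1])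
      have h7 : 0 ≤ (1 - η) * (β - x t) := mul_nonneg (by linarith) (by linarith [ht.2])
      constructor
      · simp only [y, m, hw0 t hts]; linarith
      · simp only [y, m, hw0 t hts]; linarith
  have hym : AEStronglyMeasurable y μ :=
    (hx.1.sub ((hx.1.sub aestronglyMeasurable_const).const_mul η)).add
      (hwm.aestronglyMeasurable.const_mul η)
  refine ⟨y, ε, hε, ?_, hyI, fun i => ?_⟩
  · refine memLp_top_of_bound hym (max |α + ε| |β - ε|) ?_
    filter_upwards [hyI] with t ht
    exact abs_le_max_abs_abs ht.1 ht.2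
  · have hxa : Integrable (fun t => x t * a i t) μ := by
      refine (hai i).bdd_mul (c := max |α| |β|) hx.1 ?_
      filter_upwards [hxab] with t ht
      exact abs_le_max_abs_abs ht.1 ht.2
    have hxma : Integrable (fun t => (x t - m) * a i t) μ := by
      have := hxa.sub ((hai i).const_mul m)
      refine this.congr (Filter.Eventually.of_forall fun t => ?_)
      simp only [Pi.sub_apply]; ring
    have hwi : Integrable (fun t => w t * a i t) μ := hwa d i
    have hdi : ∫ t, w t * a i t ∂μ = ∫ t, (x t - m) * a i t ∂μ := by
      rw [← congrFun hd i]
      exact (hGd d i).symm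
    have hyy : ∀ t, y t * a i t
        = (x t * a i t - η * ((x t - m) * a i t)) + η * (w t * a i t) := by
      intro t
      simp only [y]; ring
    simp only [hyy]
    have hsub : Integrable (fun t => x t * a i t - η * ((x t - m) * a i t)) μ :=
      hxa.sub (hxma.const_mul η)
    rw [integral_add hsub (hwi.const_mul η),
      integral_sub hxa (hxma.const_mul η), integral_const_mul, integral_const_mul, hdi]
    ring
end

section
/- Let (T, μ) be a finite measure space, let T₁ ⊆ T be measurable with μ(T₁) > 0, and let a₁, …, aₙ ∈ L^q(T) (1 ≤ q ≤ ∞) be linearly independent on T₁, meaning that no nontrivial linear combination ∑ᵢ λᵢ aᵢ vanishes almost everywhere on T₁. Then the set {(∫_{T₁} u a₁ dμ, …, ∫_{T₁} u aₙ dμ) : u ∈ L^∞(T₁)} equals all of ℝⁿ. -/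
open MeasureTheory Set
open scoped ENNReal NNReal

/-- **Claim** (`BL2.10`). Let `(T,μ)` be a finite measure space, `T₁ ⊆ T` measurable
with `μ(T₁) > 0`, and let `a₁,…,aₙ ∈ L^q(T)` (`1 ≤ q ≤ ∞`) be linearly independent on
`T₁`. Then `{(∫_{T₁} u a₁ dμ, …, ∫_{T₁} u aₙ dμ) : u ∈ L^∞(T₁)} = ℝⁿ`. -/
theorem stmt_6 {T : Type*} [MeasurableSpace T] (μ : Measure T) [IsFiniteMeasure μ]
    {n : ℕ} (q : ℝ≥0∞) (hq : 1 ≤ q)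
    (T₁ : Set T) (hT₁ : MeasurableSet T₁) (hμT₁ : 0 < μ T₁)
    (a : Fin n → T → ℝ) (ha : ∀ i, MemLp (a i) q μ)
    (hli : ∀ l : Fin n → ℝ,
      (∀ᵐ t ∂(μ.restrict T₁), ∑ i, l i * a i t = 0) → l = 0) :
    {v : Fin n → ℝ | ∃ u : T → ℝ, MemLp u ⊤ (μ.restrict T₁) ∧
        ∀ i, v i = ∫ t in T₁, u t * a i t ∂μ} = Set.univ := by
  have ha_int : ∀ i, Integrable (a i) (μ.restrict T₁) := fun i =>
    ((ha i).integrable hq).mono_measure Measure.restrict_le_self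
  have hmul : ∀ u : T → ℝ, MemLp u ⊤ (μ.restrict T₁) → ∀ i,
      Integrable (fun t => u t * a i t) (μ.restrict T₁) := fun u hu i =>
    (ha_int i).mul_of_top_right hu
  let S : Submodule ℝ (Fin n → ℝ) :=
    { carrier := {v : Fin n → ℝ | ∃ u : T → ℝ, MemLp u ⊤ (μ.restrict T₁) ∧
        ∀ i, v i = ∫ t in T₁, u t * a i t ∂μ}
      add_mem' := by
        rintro v w ⟨u, hu, hv⟩ ⟨u', hu', hw⟩
        refine ⟨u + u', hu.add hu', fun i => ?_⟩
        simp only [Pi.add_apply, add_mul]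
        rw [integral_add (hmul u hu i) (hmul u' hu' i), hv, hw]
      zero_mem' := ⟨0, MemLp.zero, fun i => by simp⟩
      smul_mem' := by
        rintro c v ⟨u, hu, hv⟩
        refine ⟨c • u, hu.const_smul c, fun i => ?_⟩
        simp only [Pi.smul_apply, smul_eq_mul, mul_assoc]
        rw [integral_const_mul, hv] }
  suffices h : S = ⊤ by
    have h2 : (S : Set (Fin n → ℝ)) = Set.univ := by rw [h]; rfl
    exact h2
  by_contra hS
  obtain ⟨f, hf0, hf⟩ := Submodule.exists_le_ker_of_lt_top S (lt_top_iff_ne_top.mpr hS)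
  have hfv : ∀ v, f v = ∑ i, v i * f (Pi.single i 1) := by
    intro v
    rw [LinearMap.pi_apply_eq_sum_univ f v]
    refine Finset.sum_congr rfl fun i _ => ?_
    rw [smul_eq_mul]
    congr 2
    ext j
    simp [Pi.single_apply, eq_comm]
  have hl := hli (fun i => f (Pi.single i 1)) (by
    have hg : Integrable (fun t => ∑ i, f (Pi.single i 1) * a i t) (μ.restrict T₁) :=
      integrable_finsetSum _ fun i _ => (ha_int i).const_mul _
    refine hg.ae_eq_zero_of_forall_setIntegral_eq_zero fun s hs _ => ?_
    have hu : MemLp (s.indicator (fun _ => (1 : ℝ))) ⊤ (μ.restrict T₁) :=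
      (memLp_const 1).indicator hs
    have hmem : (fun i => ∫ t in T₁, s.indicator (fun _ => (1 : ℝ)) t * a i t ∂μ) ∈ S :=
      ⟨_, hu, fun i => rfl⟩
    have h0 := hf hmem
    rw [LinearMap.mem_ker, hfv] at h0
    rw [integral_finsetSum _ fun i _ => ((ha_int i).const_mul _).integrableOn, ← h0]
    refine Finset.sum_congr rfl fun i _ => ?_
    rw [integral_const_mul, mul_comm, ← integral_indicator hs]
    congr 2
    ext t
    by_cases ht : t ∈ s <;> simp [ht])
  apply hf0
  ext v
  simp [congrFun hl]
end

section
/- Let f : ℝ → (-∞, +∞] be a proper, closed, convex function, let τ > 0, and suppose there exist x₀ ∈ L¹([0,τ]) with ∫₀^τ f(x₀(s)) ds < ∞ and y₀ ∈ L^∞([0,τ]) with ∫₀^τ f*(y₀(s)) ds < ∞. Then the Fenchel conjugate of the entropy functional I_f (with respect to the pairing ⟨x, y⟩ = ∫₀^τ x(s)y(s) ds between L¹([0,τ]) and L^∞([0,τ])) equals I_{f*}: for every y ∈ L^∞([0,τ]), sup_{x ∈ L¹([0,τ])} (∫₀^τ x(s)y(s) ds − ∫₀^τ f(x(s)) ds)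 = ∫₀^τ f*(y(s)) ds. -/
open MeasureTheory Set
open scoped ENNReal NNReal

/-- The Fenchel conjugate of `f : ℝ → (-∞,∞]`. -/
noncomputable def fenchelConj (f : ℝ → EReal) (v : ℝ) : EReal :=
  ⨆ u : ℝ, ((u * v : ℝ) : EReal) - f u

section helpers
open Filter Topology

theorem ei_mono {α : Type*} [MeasurableSpace α] {μ : Measure α} {F G : α → EReal}
    (h : ∀ᵐ a ∂μ, F a ≤ G a) : eintegral μ F ≤ eintegral μ G := by
  unfold eintegral
  apply EReal.sub_le_sub
  · norm_cast
    apply lintegral_mono_ae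
    filter_upwards [h] with a ha using EReal.toENNReal_le_toENNReal ha
  · norm_cast
    apply lintegral_mono_ae
    filter_upwards [h] with a ha using EReal.toENNReal_le_toENNReal (EReal.neg_le_neg_iff.2 ha)

theorem ei_congr {α : Type*} [MeasurableSpace α] {μ : Measure α} {F G : α → EReal}
    (h : ∀ᵐ a ∂μ, F a = G a) : eintegral μ F = eintegral μ G :=
  le_antisymm (ei_mono (h.mono fun _ e => e.le)) (ei_mono (h.mono fun _ e => e.ge))

theorem ei_coe {α : Type*} [MeasurableSpace α] {μ : Measure α} {g : α → ℝ}
    (hg : Integrable g μ) : eintegral μ (fun a => (g a : EReal)) = ((∫ a, g a ∂μ : ℝ) : EReal) := by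
  unfold eintegral
  have e1 : ∀ a, erealToENNReal (g a : EReal) = ENNReal.ofReal (g a) := fun a => rfl
  have e2 : ∀ a, erealToENNReal (-(g a : EReal)) = ENNReal.ofReal (-(g a)) := fun a => rfl
  simp only [e1, e2]
  rw [integral_eq_lintegral_pos_part_sub_lintegral_neg_part hg, EReal.coe_sub]
  have h1 : ∫⁻ a, ENNReal.ofReal (g a) ∂μ ≠ ⊤ := hg.lintegral_lt_top.ne
  have h2 : ∫⁻ a, ENNReal.ofReal (-(g a)) ∂μ ≠ ⊤ := hg.neg.lintegral_lt_top.ne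
  generalize ∫⁻ a, ENNReal.ofReal (g a) ∂μ = A at *
  generalize ∫⁻ a, ENNReal.ofReal (-(g a)) ∂μ = C at *
  lift A to ℝ≥0 using h1
  lift C to ℝ≥0 using h2
  rfl

/-- If `F` has an integrable minorant and integral `< ⊤`, then it is a.e. real and integrable. -/
theorem ei_finite {α : Type*} [MeasurableSpace α] {μ : Measure α} {F : α → EReal} {g : α → ℝ}
    (hF : AEMeasurable F μ) (hg : Integrable g μ) (hgF : ∀ᵐ a ∂μ, (g a : EReal) ≤ F a)
    (hlt : eintegral μ F < ⊤) :
    Integrable (fun a => (F a).toReal) μ ∧ ∀ᵐ a ∂μ, (((F a).toReal : ℝ) : EReal) = F a := by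
  have hC : ∫⁻ a, erealToENNReal (-(F a)) ∂μ ≠ ⊤ := by
    have h2 : ∫⁻ a, ENNReal.ofReal (-(g a)) ∂μ ≠ ⊤ := hg.neg.lintegral_lt_top.ne
    refine ne_top_of_le_ne_top h2 (lintegral_mono_ae ?_)
    filter_upwards [hgF] with a ha
    exact EReal.toENNReal_le_toENNReal (EReal.neg_le_neg_iff.2 ha)
  have hA : ∫⁻ a, erealToENNReal (F a) ∂μ ≠ ⊤ := by
    intro h
    unfold eintegral at hlt
    rw [h] at hlt
    lift (∫⁻ a, erealToENNReal (-(F a)) ∂μ) to ℝ≥0 using hC with c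
    exact absurd hlt (by
      have : ((c : ℝ≥0∞) : EReal) = ((c : ℝ) : EReal) := rfl
      rw [this]; simp)
  have hAm : AEMeasurable (fun a => erealToENNReal (F a)) μ := hF.ereal_toENNReal
  have hCm : AEMeasurable (fun a => erealToENNReal (-(F a))) μ := hF.neg.ereal_toENNReal
  have hreal : ∀ᵐ a ∂μ, (((F a).toReal : ℝ) : EReal) = F a := by
    filter_upwards [ae_lt_top' hAm hA, hgF] with a ha hb
    apply EReal.coe_toReal
    · intro h; rw [h] at ha; exact absurd ha (by simp [erealToENNReal])
    · intro h; rw [h] at hb; simp at hb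
  refine ⟨?_, hreal⟩
  have := (integrable_toReal_of_lintegral_ne_top hAm hA).sub
    (integrable_toReal_of_lintegral_ne_top hCm hC)
  refine this.congr ?_
  filter_upwards [hreal] with a ha
  change (erealToENNReal (F a)).toReal - (erealToENNReal (-(F a))).toReal = (F a).toReal
  generalize (F a).toReal = r at ha ⊢
  rw [← ha]
  change (ENNReal.ofReal r).toReal - (ENNReal.ofReal (-r)).toReal = r
  rw [ENNReal.toReal_ofReal', ENNReal.toReal_ofReal']
  rcases le_total 0 r with h | h
  · rw [max_eq_left h, max_eq_right (by linarith)]; ring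
  · rw [max_eq_right h, max_eq_left (by linarith)]; ring

theorem ei_mct {α : Type*} [MeasurableSpace α] {μ : Measure α} {F : α → EReal} {h : ℕ → α → ℝ}
    (hi : ∀ n, Integrable (h n) μ) (hm : ∀ a, Monotone fun n => h n a)
    (ht : ∀ᵐ a ∂μ, Tendsto (fun n => (h n a : EReal)) atTop (𝓝 (F a))) :
    Tendsto (fun n => ((∫ a, h n a ∂μ : ℝ) : EReal)) atTop (𝓝 (eintegral μ F)) := by
  simp_rw [← fun n => ei_coe (hi n)]
  have hmE : ∀ a, Monotone fun n => (h n a : EReal) := fun a m n hmn =>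
    EReal.coe_le_coe_iff.2 (hm a hmn)
  have hA : Tendsto (fun n => ∫⁻ a, erealToENNReal (h n a : EReal) ∂μ) atTop
      (𝓝 (∫⁻ a, erealToENNReal (F a) ∂μ)) := by
    apply lintegral_tendsto_of_tendsto_of_monotone
    · intro n; exact (hi n).aemeasurable.coe_real_ereal.ereal_toENNReal
    · exact ae_of_all _ fun a m n hmn => EReal.toENNReal_le_toENNReal (hmE a hmn)
    · filter_upwards [ht] with a ha
      exact (EReal.continuous_toENNReal.tendsto _).comp ha
  have h0 : ∫⁻ a, erealToENNReal (-(h 0 a : EReal)) ∂μ ≠ ⊤ := (hi 0).neg.lintegral_lt_top.ne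
  have hC : Tendsto (fun n => ∫⁻ a, erealToENNReal (-(h n a : EReal)) ∂μ) atTop
      (𝓝 (∫⁻ a, erealToENNReal (-(F a)) ∂μ)) := by
    apply lintegral_tendsto_of_tendsto_of_antitone
    · intro n; exact (hi n).aemeasurable.coe_real_ereal.neg.ereal_toENNReal
    · exact ae_of_all _ fun a m n hmn =>
        EReal.toENNReal_le_toENNReal (EReal.neg_le_neg_iff.2 (hmE a hmn))
    · exact h0
    · filter_upwards [ht] with a ha
      exact (EReal.continuous_toENNReal.tendsto _).comp ((continuous_neg.tendsto _).comp ha)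
  have hCt : ∫⁻ a, erealToENNReal (-(F a)) ∂μ ≠ ⊤ := by
    refine ne_top_of_le_ne_top h0 (lintegral_mono_ae ?_)
    filter_upwards [ht] with a ha
    exact EReal.toENNReal_le_toENNReal (EReal.neg_le_neg_iff.2 ((hmE a).ge_of_tendsto ha 0))
  unfold eintegral
  simp only [sub_eq_add_neg]
  refine (EReal.continuousAt_add (p := (_, _)) ?_ ?_).tendsto.comp (Tendsto.prodMk_nhds
    ((continuous_coe_ennreal_ereal.tendsto _).comp hA)
    ((continuous_neg.tendsto _).comp ((continuous_coe_ennreal_ereal.tendsto _).comp hC)))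
  · right; simpa using hCt
  · left; simp

theorem le_fc (f : ℝ → EReal) (u v r : ℝ) (h : f u ≤ r) :
    ((u * v - r : ℝ) : EReal) ≤ fenchelConj f v := by
  refine le_trans ?_ (le_iSup _ u)
  rw [EReal.coe_sub]
  exact EReal.sub_le_sub le_rfl h

/-- Countable representation of the conjugate. -/
theorem fc_countable (f : ℝ → EReal) (hbot : ∀ u : ℝ, f u ≠ ⊥) (hproper : ∃ u : ℝ, f u ≠ ⊤) :
    ∃ p : ℕ → ℝ × ℝ, (∀ n, f (p n).1 ≤ ((p n).2 : ℝ)) ∧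
      ∀ (v : ℝ) (M : EReal), (∀ n, (((p n).1 * v - (p n).2 : ℝ) : EReal) ≤ M) →
        fenchelConj f v ≤ M := by
  let E : Set (ℝ × ℝ) := {p | f p.1 ≤ (p.2 : ℝ)}
  have hE : Nonempty E := by
    obtain ⟨u, hu⟩ := hproper
    exact ⟨⟨(u, (f u).toReal), by
      change f u ≤ _
      rw [EReal.coe_toReal hu (hbot u)]⟩⟩
  refine ⟨fun n => (TopologicalSpace.denseSeq E n).1,
    fun n => (TopologicalSpace.denseSeq E n).2, fun v M hM => ?_⟩
  refine iSup_le fun u => ?_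
  by_cases hu : f u = ⊤
  · rw [hu]; simp
  have hr := EReal.coe_toReal hu (hbot u)
  have key : ∀ q : E, ((q.1.1 * v - q.1.2 : ℝ) : EReal) ≤ M := fun q => by
    refine (TopologicalSpace.denseRange_denseSeq E).induction_on
      (p := fun q : E => ((q.1.1 * v - q.1.2 : ℝ) : EReal) ≤ M) q ?_ hM
    refine isClosed_le (continuous_coe_real_ereal.comp ?_) continuous_const
    fun_prop
  have := key ⟨(u, (f u).toReal), by change f u ≤ _; rw [hr]⟩
  simp only [EReal.coe_sub, hr] at this
  exact this

/-- `h` is of the form `x y - ρ` with `f ∘ x ≤ ρ`. -/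
def Achiev {α : Type*} [MeasurableSpace α] (μ : Measure α) (f : ℝ → EReal) (y : α → ℝ)
    (h : α → ℝ) : Prop :=
  ∃ x ρ : α → ℝ, Measurable x ∧ Measurable ρ ∧ Integrable x μ ∧ Integrable ρ μ ∧
    (∀ᵐ a ∂μ, f (x a) ≤ (ρ a : ℝ)) ∧ ∀ a, h a = x a * y a - ρ a

theorem Achiev.max {α : Type*} [MeasurableSpace α] {μ : Measure α} {f : ℝ → EReal} {y : α → ℝ}
    (hy : Measurable y) {h k : α → ℝ} (hh : Achiev μ f y h) (hk : Achiev μ f y k) :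
    Achiev μ f y (fun a => max (h a) (k a)) := by
  classical
  obtain ⟨x, ρ, mx, mρ, ix, iρ, hf, he⟩ := hh
  obtain ⟨x', ρ', mx', mρ', ix', iρ', hf', he'⟩ := hk
  let s : Set α := {a | x' a * y a - ρ' a ≤ x a * y a - ρ a}
  have hs : MeasurableSet s :=
    measurableSet_le ((mx'.mul hy).sub mρ') ((mx.mul hy).sub mρ)
  refine ⟨s.piecewise x x', s.piecewise ρ ρ', mx.piecewise hs mx', mρ.piecewise hs mρ',
    Integrable.piecewise hs ix.integrableOn ix'.integrableOn,
    Integrable.piecewise hs iρ.integrableOn iρ'.integrableOn, ?_, ?_⟩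
  · filter_upwards [hf, hf'] with a h1 h2
    by_cases ha : a ∈ s <;> simp [ha, h1, h2]
  · intro a
    change Max.max (h a) (k a) = _
    rw [he, he']
    by_cases ha : a ∈ s
    · simp only [Set.piecewise_eq_of_mem _ _ _ ha]; exact max_eq_left ha
    · simp only [Set.piecewise_eq_of_notMem _ _ _ ha]; exact max_eq_right (not_le.1 ha).le

end helpers

/-- **Proposition** (`prop:Ifduality`, `(I_f)* = I_{f*}`). Let `f` be proper, closed
and convex, and suppose there are `x₀ ∈ L¹([0,τ])` with `∫ f(x₀) < ∞` and
`y₀ ∈ L^∞([0,τ])` with `∫ f*(y₀) < ∞`. Then for every `y ∈ L^∞([0,τ])`,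
`sup_{x ∈ L¹} ( ∫ x y − ∫ f(x(s)) ds ) = ∫ f*(y(s)) ds`. -/
theorem stmt_10 (f : ℝ → EReal)
    (hbot : ∀ u : ℝ, f u ≠ ⊥) (hproper : ∃ u : ℝ, f u ≠ ⊤)
    (hclosed : LowerSemicontinuous f) (hconv : ERealConvexOnReal f)
    (τ : ℝ) (hτ : 0 < τ)
    (x₀ : ℝ → ℝ) (hx₀ : IntegrableOn x₀ (Set.Icc 0 τ))
    (hIx₀ : eintegral (volume.restrict (Set.Icc 0 τ)) (fun s => f (x₀ s)) < ⊤)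
    (y₀ : ℝ → ℝ) (hy₀ : MemLp y₀ ⊤ (volume.restrict (Set.Icc 0 τ)))
    (hIy₀ : eintegral (volume.restrict (Set.Icc 0 τ)) (fun s => fenchelConj f (y₀ s)) < ⊤)
    (y : ℝ → ℝ) (hy : MemLp y ⊤ (volume.restrict (Set.Icc 0 τ))) :
    (⨆ x : {x : ℝ → ℝ // IntegrableOn x (Set.Icc 0 τ)},
        (((∫ s in Set.Icc (0 : ℝ) τ, x.1 s * y s : ℝ)) : EReal) -
          eintegral (volume.restrict (Set.Icc 0 τ)) (fun s => f (x.1 s))) =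
      eintegral (volume.restrict (Set.Icc 0 τ)) (fun s => fenchelConj f (y s)) := by
  have _ := hconv
  have _ := hτ
  set μ := volume.restrict (Set.Icc (0 : ℝ) τ) with hμ
  have hfin : IsFiniteMeasure μ := by rw [hμ]; infer_instance
  have hfm : Measurable f := hclosed.measurable
  have hprodI : ∀ {x y : ℝ → ℝ}, Integrable x μ → MemLp y ⊤ μ →
      Integrable (fun s => x s * y s) μ := fun hx hy =>
    (memLp_one_iff_integrable.2 hx).integrable_mul hy
  obtain ⟨p, hpE, hpS⟩ := fc_countable f hbot hproper
  -- an affine minorant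
  have hfcm : Measurable (fenchelConj f) := by
    have : fenchelConj f = fun v => ⨆ n, (((p n).1 * v - (p n).2 : ℝ) : EReal) := by
      funext v
      apply le_antisymm
      · exact hpS v _ fun n => le_iSup (fun n => (((p n).1 * v - (p n).2 : ℝ) : EReal)) n
      · exact iSup_le fun n => le_fc f _ _ _ (hpE n)
    rw [this]
    refine Measurable.iSup fun n => Measurable.coe_real_ereal ?_
    fun_prop
  obtain ⟨v, c, hvc⟩ : ∃ v c : ℝ, ∀ u : ℝ, ((u * v - c : ℝ) : EReal) ≤ f u := by
    have hg : Integrable (fun s => (p 0).1 * y₀ s - (p 0).2) μ :=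
      ((hy₀.integrable le_top).const_mul _).sub (integrable_const _)
    have h := (ei_finite (hfcm.comp_aemeasurable hy₀.1.aemeasurable) hg
      (ae_of_all _ fun s => le_fc f _ _ _ (hpE 0)) hIy₀).2
    have hne : (ae μ).NeBot := by
      rw [ae_neBot, hμ, Ne, Measure.restrict_eq_zero]; simp [hτ]
    obtain ⟨s, hs⟩ := h.exists
    refine ⟨y₀ s, (fenchelConj f (y₀ s)).toReal, fun u => ?_⟩
    by_cases hu : f u = ⊤
    · rw [hu]; exact le_top
    have hr := EReal.coe_toReal hu (hbot u)
    have h1 := le_fc f u (y₀ s) (f u).toReal hr.ge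
    change (((fenchelConj f (y₀ s)).toReal : ℝ) : EReal) = fenchelConj f (y₀ s) at hs
    rw [← hs, EReal.coe_le_coe_iff] at h1
    rw [← hr, EReal.coe_le_coe_iff]
    linarith
  have hfx : ∀ x : ℝ → ℝ, Integrable x μ → eintegral μ (fun s => f (x s)) < ⊤ →
      Integrable (fun s => (f (x s)).toReal) μ ∧
        ∀ᵐ s ∂μ, (((f (x s)).toReal : ℝ) : EReal) = f (x s) := fun x hx hlt =>
    ei_finite (g := fun s => x s * v - c) (hfm.comp_aemeasurable hx.aemeasurable)
      ((hx.mul_const v).sub (integrable_const c)) (ae_of_all _ fun s => hvc _) hlt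
  apply le_antisymm
  · refine iSup_le fun ⟨x, hx⟩ => ?_
    change Integrable x μ at hx
    by_cases hlt : eintegral μ (fun s => f (x s)) < ⊤
    · obtain ⟨hi, he⟩ := hfx x hx hlt
      change ((∫ s, x s * y s ∂μ : ℝ) : EReal) - eintegral μ (fun s => f (x s)) ≤ _
      rw [← ei_congr he, ei_coe hi, ← EReal.coe_sub, ← integral_sub (hprodI hx hy) hi,
        ← ei_coe (g := fun s => x s * y s - (f (x s)).toReal) ((hprodI hx hy).sub hi)]
      apply ei_mono
      filter_upwards [he] with s hs
      exact le_fc f _ _ _ hs.ge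
    · rw [not_lt, top_le_iff] at hlt
      simp only [hlt]
      simp
  · -- lower bound
    have hym := hy.1.aemeasurable
    let z := hym.mk y
    have hzm : Measurable z := hym.measurable_mk
    have hyz : y =ᵐ[μ] z := hym.ae_eq_mk
    have hz : MemLp z ⊤ μ := hy.ae_eq hyz
    have ach0 : ∃ h, Achiev μ f z h := by
      have hxm := hx₀.aemeasurable
      have hxe := hxm.ae_eq_mk
      have hi : Integrable (hxm.mk x₀) μ := (integrable_congr hxe).1 hx₀
      have hlt : eintegral μ (fun s => f (hxm.mk x₀ s)) < ⊤ := by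
        rw [ei_congr (G := fun s => f (x₀ s))]
        · exact hIx₀
        · filter_upwards [hxe] with s hs; rw [← hs]
      obtain ⟨h1, h2⟩ := hfx _ hi hlt
      exact ⟨_, _, _, hxm.measurable_mk, (hfm.comp hxm.measurable_mk).ereal_toReal, hi, h1,
        h2.mono fun s hs => hs.ge, fun s => rfl⟩
    obtain ⟨h0, hh0⟩ := ach0
    obtain ⟨h, hzero, hsucc⟩ : ∃ h : ℕ → ℝ → ℝ, h 0 = h0 ∧
        ∀ n s, h (n + 1) s = max (h n s) ((p n).1 * z s - (p n).2) :=
      ⟨fun n => Nat.rec h0 (fun n k s => max (k s) ((p n).1 * z s - (p n).2)) n,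
        rfl, fun n s => rfl⟩
    have hach : ∀ n, Achiev μ f z (h n) := by
      intro n
      induction n with
      | zero => rw [hzero]; exact hh0
      | succ n ih =>
        rw [funext (hsucc n)]
        refine ih.max hzm ⟨fun _ => (p n).1, fun _ => (p n).2, measurable_const, measurable_const,
          integrable_const _, integrable_const _, ae_of_all _ fun _ => hpE n, fun s => rfl⟩
    have hint : ∀ n, Integrable (h n) μ := by
      intro n
      obtain ⟨x, ρ, mx, mρ, ix, iρ, hf, he⟩ := hach n
      rw [funext he]
      exact (hprodI ix hz).sub iρ
    have hmono : ∀ s, Monotone fun n => h n s := fun s =>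
      monotone_nat_of_le_succ fun n => by rw [hsucc]; exact le_max_left _ _
    have hle : ∀ᵐ s : ℝ ∂μ, ∀ n : ℕ, Real.toEReal (h n s) ≤ fenchelConj f (z s) := by
      rw [ae_all_iff]
      intro n
      obtain ⟨x, ρ, mx, mρ, ix, iρ, hf, he⟩ := hach n
      filter_upwards [hf] with s hs
      rw [he]
      exact le_fc f _ _ _ hs
    have hlim : ∀ᵐ s ∂μ, Filter.Tendsto (fun n => (h n s : EReal)) Filter.atTop
        (nhds (fenchelConj f (z s))) := by
      filter_upwards [hle] with s hs
      have e : fenchelConj f (z s) = ⨆ n, (h n s : EReal) := by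
        apply le_antisymm
        · refine hpS _ _ fun n => le_trans ?_ (le_iSup (fun n => (h n s : EReal)) (n + 1))
          rw [EReal.coe_le_coe_iff, hsucc]
          exact le_max_right _ _
        · exact iSup_le hs
      rw [e]
      exact tendsto_atTop_iSup fun m n hmn => EReal.coe_le_coe_iff.2 (hmono s hmn)
    have hT := ei_mct hint hmono hlim
    rw [ei_congr (G := fun s => fenchelConj f (z s))
      (by filter_upwards [hyz] with s hs; rw [hs])]
    refine le_of_tendsto' hT fun n => ?_
    obtain ⟨x, ρ, mx, mρ, ix, iρ, hf, he⟩ := hach n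
    refine le_trans ?_ (le_iSup _ ⟨x, ix⟩)
    change _ ≤ ((∫ s, x s * y s ∂μ : ℝ) : EReal) - eintegral μ (fun s => f (x s))
    have e1 : ∫ s, h n s ∂μ = ∫ s, x s * y s ∂μ - ∫ s, ρ s ∂μ := by
      rw [← integral_sub (hprodI ix hy) iρ]
      apply integral_congr_ae
      filter_upwards [hyz] with s hs
      rw [he, hs]
    rw [e1, EReal.coe_sub, ← ei_coe iρ]
    exact EReal.sub_le_sub le_rfl (ei_mono hf)
end

section
/- Let X be a locally convex topological vector space, let C ⊆ X be convex, and let A : X → ℝⁿ be continuous and linear. If qri C ≠ ∅, then A(qri C) = ri(AC), the relative interior of the image AC in ℝⁿ. -/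
open MeasureTheory Set
open scoped ENNReal NNReal

/-- The quasi-relative interior of a set `C` in a topological vector space:
the points `x ∈ C` such that the closure of the cone `{t(c − x) : t ≥ 0, c ∈ C}`
is a linear subspace. -/
def qri {X : Type*} [AddCommGroup X] [Module ℝ X] [TopologicalSpace X]
    (C : Set X) : Set X :=
  {x ∈ C | ∃ S : Submodule ℝ X,
    closure {y : X | ∃ t : ℝ, 0 ≤ t ∧ ∃ c ∈ C, y = t • (c - x)} = (S : Set X)}

lemma aux_qri_combo {X : Type*} [AddCommGroup X] [Module ℝ X] [TopologicalSpace X]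
    {C : Set X} (hC : Convex ℝ C) {x c : X} (hx : x ∈ qri C) (hc : c ∈ C)
    {l : ℝ} (h0 : 0 < l) (h1 : l ≤ 1) : (1 - l) • c + l • x ∈ qri C := by
  obtain ⟨hxC, S, hS⟩ := hx
  have hmem : ∀ d ∈ C, d - x ∈ S := by
    intro d hd
    have : d - x ∈ (S : Set X) := by
      rw [← hS]
      exact subset_closure ⟨1, zero_le_one, d, hd, by simp⟩
    exact this
  have hScl : IsClosed (S : Set X) := by rw [← hS]; exact isClosed_closure
  refine ⟨hC hc hxC (by linarith) h0.le (by ring), S, ?_⟩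
  apply Set.Subset.antisymm
  · apply closure_minimal _ hScl
    rintro y ⟨t, ht, d, hd, rfl⟩
    have : d - ((1 - l) • c + l • x) = (d - x) - (1 - l) • (c - x) := by module
    rw [this]
    exact S.smul_mem _ (S.sub_mem (hmem d hd) (S.smul_mem _ (hmem c hc)))
  · rw [← hS]
    apply closure_mono
    rintro y ⟨t, ht, d, hd, rfl⟩
    refine ⟨t / l, by positivity, (1 - l) • c + l • d,
      hC hc hd (by linarith) h0.le (by ring), ?_⟩
    have : (1 - l) • c + l • d - ((1 - l) • c + l • x) = l • (d - x) := by module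
    rw [this, smul_smul, div_mul_cancel₀ _ h0.ne']

lemma aux_interior {T : Type*} [NormedAddCommGroup T] [NormedSpace ℝ T] [FiniteDimensional ℝ T]
    {E : Set T} (hE : Convex ℝ E) (h0 : (0 : T) ∈ E)
    (hd : Dense {y : T | ∃ t : ℝ, 0 ≤ t ∧ ∃ c ∈ E, y = t • c}) : (0 : T) ∈ interior E := by
  have hne : (interior E).Nonempty := by
    rw [hE.interior_nonempty_iff_affineSpan_eq_top,
      AffineSubspace.affineSpan_eq_top_iff_vectorSpan_eq_top_of_nonempty ℝ T T ⟨0, h0⟩]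
    have hcl : IsClosed (vectorSpan ℝ E : Set T) := Submodule.closed_of_finiteDimensional _
    have hsub : {y : T | ∃ t : ℝ, 0 ≤ t ∧ ∃ c ∈ E, y = t • c} ⊆ (vectorSpan ℝ E : Set T) := by
      rintro y ⟨t, -, c, hc, rfl⟩
      have := vsub_mem_vectorSpan ℝ hc h0
      exact Submodule.smul_mem _ _ (by simpa using this)
    have := closure_minimal hsub hcl
    rw [hd.closure_eq] at this
    exact eq_top_iff.2 fun v _ => this (mem_univ v)
  by_contra hcon
  obtain ⟨f, hf⟩ := geometric_hahn_banach_open_point hE.interior isOpen_interior hcon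
  simp only [map_zero] at hf
  have hle : ∀ a ∈ E, f a ≤ 0 := by
    intro a ha
    have h1 : a ∈ closure (interior E) := by
      rw [hE.closure_interior_eq_closure_of_nonempty_interior hne]
      exact subset_closure ha
    exact closure_minimal (fun b hb => (hf b hb).le : interior E ⊆ {b | f b ≤ 0})
      (isClosed_le f.continuous continuous_const) h1
  have hall : ∀ v, f v ≤ 0 := by
    intro v
    have hsub : {y : T | ∃ t : ℝ, 0 ≤ t ∧ ∃ c ∈ E, y = t • c} ⊆ {b | f b ≤ 0} := by
      rintro y ⟨t, ht, c, hc, rfl⟩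
      have := hle c hc
      simp only [mem_ofPred_eq, map_smul, smul_eq_mul]
      exact mul_nonpos_of_nonneg_of_nonpos ht this
    exact closure_minimal hsub (isClosed_le f.continuous continuous_const) (hd v)
  obtain ⟨a, ha⟩ := hne
  have h1 := hf a ha
  have h2 := hall (-a)
  rw [map_neg] at h2
  linarith

lemma aux_ri {V : Type*} [NormedAddCommGroup V] [NormedSpace ℝ V] [FiniteDimensional ℝ V]
    {D : Set V} (hD : Convex ℝ D) {y : V} (hy : y ∈ D) (T : Submodule ℝ V)
    (hDT : ∀ d ∈ D, d - y ∈ T)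
    (hT : (T : Set V) ⊆ closure {v : V | ∃ t : ℝ, 0 ≤ t ∧ ∃ d ∈ D, v = t • (d - y)}) :
    y ∈ intrinsicInterior ℝ D := by
  let E : Set T := {t | y + (t : V) ∈ D}
  have hE : Convex ℝ E := by
    intro a ha b hb s t hs ht hst
    have := hD ha hb hs ht hst
    have h2 : s • (y + (a : V)) + t • (y + (b : V)) = y + ((s • a + t • b : T) : V) := by
      have : s • (y + (a : V)) + t • (y + (b : V)) = (s + t) • y + (s • (a : V) + t • (b : V)) := by
        module
      rw [this, hst]; simp
    rw [h2] at this
    exact this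
  have h0 : (0 : T) ∈ E := by simpa [E] using hy
  have hd : Dense {y : T | ∃ t : ℝ, 0 ≤ t ∧ ∃ c ∈ E, y = t • c} := by
    intro v
    rw [closure_subtype]
    refine closure_mono ?_ (hT v.2)
    rintro w ⟨t, ht, d, hd, rfl⟩
    refine ⟨t • ⟨d - y, hDT d hd⟩, ⟨t, ht, ⟨d - y, hDT d hd⟩, ?_, rfl⟩, rfl⟩
    simpa [E] using hd
  have hint := aux_interior hE h0 hd
  have hspan : ∀ p ∈ affineSpan ℝ D, p - y ∈ T := by
    have : affineSpan ℝ D ≤ AffineSubspace.mk' y T := by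
      rw [affineSpan_le]
      intro d hd
      exact (AffineSubspace.mem_mk').2 (hDT d hd)
    intro p hp
    exact (AffineSubspace.mem_mk').1 (this hp)
  let φ : affineSpan ℝ D → T := fun p => ⟨p - y, hspan p p.2⟩
  have hφ : Continuous φ := by
    apply Continuous.subtype_mk
    fun_prop
  refine mem_intrinsicInterior.2 ⟨⟨y, subset_affineSpan ℝ D hy⟩, ?_, rfl⟩
  rw [mem_interior]
  refine ⟨φ ⁻¹' interior E, ?_, isOpen_interior.preimage hφ, ?_⟩
  · intro p hp
    have := interior_subset hp
    simpa [E, φ] using this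
  · have : φ ⟨y, subset_affineSpan ℝ D hy⟩ = 0 := by simp [φ]
    rw [mem_preimage, this]
    exact hint

lemma aux_ext {V : Type*} [NormedAddCommGroup V] [NormedSpace ℝ V]
    {D : Set V} {y z : V} (hy : y ∈ intrinsicInterior ℝ D) (hz : z ∈ D) :
    ∃ e : ℝ, 0 < e ∧ y + e • (y - z) ∈ D := by
  obtain ⟨⟨y', hy'⟩, hi, rfl⟩ := mem_intrinsicInterior.1 hy
  let g : ℝ → affineSpan ℝ D := fun t => ⟨y' + t • (y' - z), by
    have := AffineSubspace.smul_vsub_vadd_mem (affineSpan ℝ D) t hy' (subset_affineSpan ℝ D hz) hy'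
    simpa [add_comm] using this⟩
  have hg : Continuous g := by
    apply Continuous.subtype_mk
    fun_prop
  have h0 : g 0 = ⟨y', hy'⟩ := by simp [g]
  have hn : g ⁻¹' (interior ((↑) ⁻¹' D)) ∈ nhds (0 : ℝ) :=
    (isOpen_interior.preimage hg).mem_nhds (by rw [mem_preimage, h0]; exact hi)
  obtain ⟨r, hr, hb⟩ := Metric.mem_nhds_iff.1 hn
  have : r / 2 ∈ Metric.ball (0 : ℝ) r := by
    rw [Metric.mem_ball, Real.dist_eq, sub_zero, abs_of_pos (by positivity)]
    linarith
  have h3 := interior_subset (hb this : g (r / 2) ∈ interior ((↑) ⁻¹' D))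
  exact ⟨r / 2, by positivity, h3⟩

/-- **Proposition** (Borwein–Lewis, Proposition 2.10 / `prop:subsetqri`).
Let `X` be locally convex, `C ⊆ X` convex and `A : X → ℝⁿ` continuous and linear.
If `qri C ≠ ∅`, then `A (qri C) = ri (A C)`. -/
theorem stmt_11 {X : Type*} [AddCommGroup X] [Module ℝ X] [TopologicalSpace X]
    [IsTopologicalAddGroup X] [ContinuousSMul ℝ X] [LocallyConvexSpace ℝ X]
    {n : ℕ} (C : Set X) (hC : Convex ℝ C)
    (A : X →L[ℝ] (Fin n → ℝ))
    (hqri : (qri C).Nonempty) :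
    A '' qri C = intrinsicInterior ℝ (A '' C) := by
  have hD : Convex ℝ (A '' C) := hC.linear_image A.toLinearMap
  apply Set.Subset.antisymm
  · rintro _ ⟨x, ⟨hxC, S, hS⟩, rfl⟩
    refine aux_ri hD ⟨x, hxC, rfl⟩ (S.map A.toLinearMap) ?_ ?_
    · rintro _ ⟨c, hc, rfl⟩
      refine ⟨c - x, ?_, by simp⟩
      rw [← hS]
      exact subset_closure ⟨1, zero_le_one, c, hc, by simp⟩
    · rintro _ ⟨s, hs, rfl⟩
      rw [← hS] at hs
      have := image_closure_subset_closure_image A.continuous (mem_image_of_mem A hs)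
      refine closure_mono ?_ this
      rintro _ ⟨_, ⟨t, ht, c, hc, rfl⟩, rfl⟩
      exact ⟨t, ht, A c, ⟨c, hc, rfl⟩, by simp⟩
  · intro y hy
    obtain ⟨x, hx⟩ := hqri
    obtain ⟨e, he, c, hc, hce⟩ := aux_ext hy (mem_image_of_mem A hx.1)
    have h1 : (0 : ℝ) < 1 + e := by linarith
    refine ⟨(1 - e / (1 + e)) • c + (e / (1 + e)) • x,
      aux_qri_combo hC hx hc (by positivity) ((div_le_one h1).2 (by linarith)), ?_⟩
    rw [map_add, map_smul, map_smul, hce]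
    ext i
    simp only [Pi.add_apply, Pi.smul_apply, Pi.sub_apply, smul_eq_mul]
    field_simp
    ring
end

section
/- Let X be a locally convex topological vector space and let C, D ⊆ X be convex sets. If C ∩ int D ≠ ∅, then (qri C) ∩ (int D) = qri(C ∩ D). -/
open MeasureTheory Set
open scoped ENNReal NNReal

/-- **Theorem** (Borwein–Lewis, Theorem 2.13 / `thm:qri_intersections`).
Let `X` be locally convex and `C, D ⊆ X` convex. If `C ∩ int D ≠ ∅`, then
`(qri C) ∩ (int D) = qri (C ∩ D)`. -/
theorem stmt_12 {X : Type*} [AddCommGroup X] [Module ℝ X] [TopologicalSpace X]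
    [IsTopologicalAddGroup X] [ContinuousSMul ℝ X] [LocallyConvexSpace ℝ X]
    (C D : Set X) (hC : Convex ℝ C) (hD : Convex ℝ D)
    (hCD : (C ∩ interior D).Nonempty) :
    qri C ∩ interior D = qri (C ∩ D) := by
  have key : ∀ x ∈ C, x ∈ interior D →
      {y : X | ∃ t : ℝ, 0 ≤ t ∧ ∃ c ∈ C ∩ D, y = t • (c - x)} =
        {y : X | ∃ t : ℝ, 0 ≤ t ∧ ∃ c ∈ C, y = t • (c - x)} := by
    intro x hxC hxD
    ext y
    constructor
    · rintro ⟨t, ht, c, hc, rfl⟩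
      exact ⟨t, ht, c, hc.1, rfl⟩
    · rintro ⟨t, ht, c, hc, rfl⟩
      have hcont : Continuous (fun e : ℝ => x + e • (c - x)) := by fun_prop
      have h0 : (fun e : ℝ => x + e • (c - x)) ⁻¹' interior D ∈ nhds (0 : ℝ) :=
        (isOpen_interior.preimage hcont).mem_nhds (by simpa using hxD)
      obtain ⟨r, hr, hball⟩ := Metric.mem_nhds_iff.1 h0
      set e : ℝ := min (r / 2) 1 with he
      have he0 : 0 < e := lt_min (by linarith) one_pos
      have he1 : e ≤ 1 := min_le_right _ _
      have her : e < r := lt_of_le_of_lt (min_le_left _ _) (by linarith)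
      have hmem : x + e • (c - x) ∈ interior D := by
        apply hball
        simp [abs_of_pos he0, her]
      refine ⟨t / e, by positivity, x + e • (c - x),
        ⟨hC.add_smul_sub_mem hxC hc ⟨he0.le, he1⟩, interior_subset hmem⟩, ?_⟩
      rw [add_sub_cancel_left, smul_smul, div_mul_cancel₀ _ he0.ne']
  have hsub : qri (C ∩ D) ⊆ interior D := by
    rintro x ⟨hx, S, hS⟩
    by_contra hxD
    obtain ⟨z, hzC, hzD⟩ := hCD
    obtain ⟨f, hf⟩ := geometric_hahn_banach_open_point hD.interior isOpen_interior hxD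
    have hle : ∀ y ∈ D, f y ≤ f x := by
      intro y hy
      have hy' : y ∈ closure (interior D) := by
        rw [hD.closure_interior_eq_closure_of_nonempty_interior ⟨z, hzD⟩]
        exact subset_closure hy
      have hcl : IsClosed {w : X | f w ≤ f x} := isClosed_le f.continuous continuous_const
      exact closure_minimal (fun w hw => (hf w hw).le) hcl hy'
    have hzS : z - x ∈ S := by
      rw [← SetLike.mem_coe, ← hS]
      exact subset_closure ⟨1, zero_le_one, z, ⟨hzC, interior_subset hzD⟩, by simp⟩
    have hn : -(z - x) ∈ (S : Set X) := S.neg_mem hzS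
    rw [← hS] at hn
    have hcl : IsClosed {w : X | f w ≤ 0} := isClosed_le f.continuous continuous_const
    have h := closure_minimal (t := {w : X | f w ≤ 0}) (by
      rintro _ ⟨t, ht, c, hc, rfl⟩
      have := hle c hc.2
      simp only [mem_setOf_eq, map_smul, map_sub, smul_eq_mul]
      exact mul_nonpos_of_nonneg_of_nonpos ht (by linarith)) hcl hn
    have h2 := hf z hzD
    simp only [mem_setOf_eq, map_neg, map_sub] at h
    linarith
  ext x
  constructor
  · rintro ⟨⟨hxC, S, hS⟩, hxD⟩
    exact ⟨⟨hxC, interior_subset hxD⟩, S, by rw [key x hxC hxD, hS]⟩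
  · intro hx
    have hxD := hsub hx
    obtain ⟨hxC, S, hS⟩ := hx
    exact ⟨⟨hxC.1, S, by rw [← key x hxC.1 hxD, hS]⟩, hxD⟩
end

section
/- Let (T, μ) be a finite measure space, let 1 ≤ p ≤ ∞ with conjugate exponent q, let ρ ∈ L^p(T) satisfy ρ ≥ 0 almost everywhere with ρ not equal to zero (μ({t : ρ(t) > 0}) > 0), and let a₁, …, aₙ ∈ L^q(T) be pseudo-Haar. Then there exist y ∈ L^∞(T) and ε > 0 with y(t) ≥ ε almost everywhere and ⟨ρ, aᵢ⟩ = ⟨y, aᵢ⟩ for each i = 1, …, n, where ⟨u, v⟩ = ∫_T u v dμ. -/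
open MeasureTheory Set
open scoped ENNReal NNReal

lemma surj_aux {T : Type*} [MeasurableSpace T] (μ : Measure T)
    {n : ℕ} (a : Fin n → T → ℝ) (ha : ∀ i, Integrable (a i) μ)
    (S : Set T) (hS : MeasurableSet S)
    (hph : ∀ l : Fin n → ℝ,
      (∀ᵐ t ∂(μ.restrict S), ∑ i, l i * a i t = 0) → l = 0) (v : Fin n → ℝ) :
    ∃ z : T → ℝ, Measurable z ∧ (∃ C, ∀ t, |z t| ≤ C) ∧ (∀ t ∉ S, z t = 0) ∧
      ∀ i, ∫ t, z t * a i t ∂μ = v i := by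
  have hint : ∀ z : T → ℝ, Measurable z → (∃ C, ∀ t, |z t| ≤ C) → ∀ i,
      Integrable (fun t => z t * a i t) μ := by
    rintro z hz ⟨C, hC⟩ i
    exact (ha i).bdd_mul hz.aestronglyMeasurable (Filter.Eventually.of_forall hC)
  let R : Submodule ℝ (Fin n → ℝ) :=
    { carrier := {v | ∃ z : T → ℝ, Measurable z ∧ (∃ C, ∀ t, |z t| ≤ C) ∧ (∀ t ∉ S, z t = 0) ∧
        ∀ i, ∫ t, z t * a i t ∂μ = v i}
      zero_mem' := ⟨fun _ => 0, measurable_const, ⟨0, by simp⟩, by simp, by simp⟩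
      add_mem' := by
        rintro v w ⟨z, hz, hzC, hzS, hzv⟩ ⟨z', hz', hzC', hzS', hzv'⟩
        refine ⟨fun t => z t + z' t, hz.add hz', ?_, ?_, ?_⟩
        · obtain ⟨C, hC⟩ := hzC
          obtain ⟨C', hC'⟩ := hzC'
          exact ⟨C + C', fun t => (abs_add_le _ _).trans (add_le_add (hC t) (hC' t))⟩
        · intro t ht
          simp [hzS t ht, hzS' t ht]
        · intro i
          simp only [add_mul, Pi.add_apply]
          rw [integral_add (hint z hz hzC i) (hint z' hz' hzC' i), hzv, hzv']
      smul_mem' := by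
        rintro c v ⟨z, hz, ⟨C, hC⟩, hzS, hzv⟩
        refine ⟨fun t => c * z t, hz.const_mul c, ⟨|c| * C, ?_⟩, ?_, ?_⟩
        · intro t
          rw [abs_mul]
          exact mul_le_mul_of_nonneg_left (hC t) (abs_nonneg c)
        · intro t ht
          simp [hzS t ht]
        · intro i
          simp only [mul_assoc, Pi.smul_apply, smul_eq_mul]
          rw [integral_const_mul, hzv] }
  suffices h : R = ⊤ by
    have : v ∈ R := h ▸ Submodule.mem_top
    exact this
  by_contra hne
  obtain ⟨φ, hφ0, hφ⟩ := Submodule.exists_le_ker_of_lt_top R (lt_top_iff_ne_top.mpr hne)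
  let l : Fin n → ℝ := fun i => φ (Pi.single i 1)
  have hφl : ∀ w, φ w = ∑ i, l i * w i := by
    intro w
    rw [LinearMap.pi_apply_eq_sum_univ φ w]
    refine Finset.sum_congr rfl fun i _ => ?_
    simp only [l, smul_eq_mul]
    rw [mul_comm]
    congr 2
    ext j
    simp [Pi.single_apply, eq_comm]
  have hl : l = 0 := by
    apply hph
    let f : T → ℝ := fun t => ∑ i, l i * a i t
    have hf : Integrable f μ := integrable_finsetSum _ fun i _ => (ha i).const_mul _
    let g := hf.1.mk f
    have hg : Measurable g := hf.1.stronglyMeasurable_mk.measurable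
    have hfg : f =ᵐ[μ] g := hf.1.ae_eq_mk
    let z : T → ℝ := S.indicator (fun t => if 0 ≤ g t then 1 else -1)
    have hz : Measurable z :=
      (Measurable.ite (measurableSet_le measurable_const hg) measurable_const
        measurable_const).indicator hS
    have hzC : ∃ C, ∀ t, |z t| ≤ C := by
      refine ⟨1, fun t => ?_⟩
      by_cases ht : t ∈ S
      · simp only [z, indicator_of_mem ht]
        split_ifs <;> simp
      · simp [z, ht]
    have hmem : (fun i => ∫ t, z t * a i t ∂μ) ∈ R :=
      ⟨z, hz, hzC, fun t ht => by simp [z, ht], fun i => rfl⟩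
    have h0 : φ (fun i => ∫ t, z t * a i t ∂μ) = 0 := hφ hmem
    rw [hφl] at h0
    have h1 : ∫ t in S, |f t| ∂μ = 0 := by
      rw [← integral_indicator hS, ← h0]
      simp_rw [← integral_const_mul]
      rw [← integral_finsetSum _ fun i _ => (hint z hz hzC i).const_mul _]
      refine integral_congr_ae ?_
      filter_upwards [hfg] with t ht
      have : ∑ i, l i * (z t * a i t) = z t * f t := by
        simp only [f, Finset.mul_sum]
        exact Finset.sum_congr rfl fun i _ => by ring
      rw [this]
      by_cases hs : t ∈ S
      · simp only [z, indicator_of_mem hs, ← ht]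
        split_ifs with hh
        · rw [abs_of_nonneg hh, one_mul]
        · rw [abs_of_neg (not_le.mp hh)]; ring
      · simp [z, hs]
    rw [integral_eq_zero_iff_of_nonneg (fun t => abs_nonneg _) hf.abs.integrableOn] at h1
    filter_upwards [h1] with t ht
    simpa using ht
  apply hφ0
  ext w
  simp [hφl, hl]

/-- **Theorem** (Borwein–Lewis, Theorem 2.9 / `thm:BLmaintheorem`). Let `(T,μ)` be a
finite measure space, `p` and `q` conjugate exponents, `0 ≤ ρ ∈ L^p(T)` nonzero, and
let `a₁,…,aₙ ∈ L^q(T)` be pseudo-Haar. Then there exist `y ∈ L^∞(T)` and `ε > 0` with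
`y(t) ≥ ε` a.e. and `⟨ρ, aᵢ⟩ = ⟨y, aᵢ⟩` for each `i`, where `⟨u,v⟩ = ∫_T u v dμ`. -/
theorem stmt_13 {T : Type*} [MeasurableSpace T] (μ : Measure T) [IsFiniteMeasure μ]
    {n : ℕ} (p q : ℝ≥0∞) (hpq : p.HolderConjugate q)
    (ρ : T → ℝ) (hρ : MemLp ρ p μ)
    (hρ0 : ∀ᵐ t ∂μ, 0 ≤ ρ t) (hρne : 0 < μ {t | 0 < ρ t})
    (a : Fin n → T → ℝ) (ha : ∀ i, MemLp (a i) q μ)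
    (hph : ∀ S : Set T, MeasurableSet S → μ S ≠ 0 → ∀ l : Fin n → ℝ,
      (∀ᵐ t ∂(μ.restrict S), ∑ i, l i * a i t = 0) → l = 0) :
    ∃ y : T → ℝ, ∃ ε > (0 : ℝ), MemLp y ⊤ μ ∧
      (∀ᵐ t ∂μ, ε ≤ y t) ∧
      ∀ i, ∫ t, ρ t * a i t ∂μ = ∫ t, y t * a i t ∂μ := by
  have hq1 : 1 ≤ q := hpq.symm.one_le
  have hai : ∀ i, Integrable (a i) μ := fun i => (ha i).integrable hq1
  obtain ⟨r, hrm, hr⟩ : ∃ r : T → ℝ, Measurable r ∧ ρ =ᵐ[μ] r :=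
    ⟨hρ.1.mk ρ, hρ.1.stronglyMeasurable_mk.measurable, hρ.1.ae_eq_mk⟩
  have hra : ∀ i, Integrable (fun t => r t * a i t) μ := fun i =>
    (MemLp.integrable_mul (hρ.ae_eq hr) (ha i))
  have heq : ∀ i, ∫ t, ρ t * a i t ∂μ = ∫ t, r t * a i t ∂μ := fun i =>
    integral_congr_ae (by filter_upwards [hr] with t ht; rw [ht])
  -- the set
  obtain ⟨m, hm⟩ : ∃ m : ℕ, μ {t | 1 / ((m : ℝ) + 1) ≤ r t ∧ r t ≤ m + 1} ≠ 0 := by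
    by_contra! hcon
    have h1 := measure_iUnion_null hcon
    have h2 : μ {t | 0 < ρ t} ≤
        μ (⋃ m : ℕ, {t | 1 / ((m : ℝ) + 1) ≤ r t ∧ r t ≤ m + 1}) := by
      refine measure_mono_ae ?_
      filter_upwards [hr] with t ht h0
      have h0 : 0 < r t := ht ▸ h0
      obtain ⟨k, hk⟩ := exists_nat_one_div_lt h0
      obtain ⟨j, hj⟩ := exists_nat_gt (r t)
      refine mem_iUnion.mpr ⟨max k j, ?_, ?_⟩
      · refine le_trans ?_ hk.le
        apply one_div_le_one_div_of_le (by positivity)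
        push_cast
        linarith [le_max_left (k : ℝ) j]
      · push_cast
        linarith [le_max_right (k : ℝ) j]
    exact absurd (h2.trans h1.le) (not_le.mpr hρne)
  set S := {t | 1 / ((m : ℝ) + 1) ≤ r t ∧ r t ≤ m + 1} with hSdef
  have hS : MeasurableSet S :=
    (measurableSet_le measurable_const hrm).inter (measurableSet_le hrm measurable_const)
  have hsurj := surj_aux μ a hai S hS (hph S hS hm)
  choose z hzm hzC hzS hzv using fun j : Fin n => hsurj (Pi.single j 1)
  choose C hC using hzC
  let cl : ℕ → T → ℝ := fun k t => min (max (r t) (1 / ((k : ℝ) + 1))) (k + 1)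
  have hclm : ∀ k, Measurable (cl k) := fun k =>
    (hrm.max measurable_const).min measurable_const
  have hk1 : ∀ k : ℕ, 0 < 1 / ((k : ℝ) + 1) ∧ 1 / ((k : ℝ) + 1) ≤ 1 := by
    intro k
    refine ⟨by positivity, ?_⟩
    rw [div_le_one (by positivity)]
    linarith [(Nat.cast_nonneg k : (0 : ℝ) ≤ k)]
  have hk0 : ∀ k : ℕ, (0 : ℝ) ≤ k := fun k => Nat.cast_nonneg k
  have hcllow : ∀ (k : ℕ) (t : T), 1 / ((k : ℝ) + 1) ≤ cl k t := by
    intro k t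
    exact le_min (le_max_right _ _) (by linarith [hk1 k, hk0 k])
  have hclup : ∀ k t, cl k t ≤ k + 1 := fun k t => min_le_right _ _
  have hclb : ∀ k t, |cl k t| ≤ |r t| + 1 := by
    intro k t
    rw [abs_of_nonneg ((hk1 k).1.le.trans (hcllow k t))]
    refine (min_le_left _ _).trans (max_le ?_ ?_)
    · linarith [le_abs_self (r t)]
    · linarith [hk1 k, abs_nonneg (r t)]
  have hcla : ∀ k i, Integrable (fun t => cl k t * a i t) μ := by
    intro k i
    refine (hai i).bdd_mul (c := k + 1) (hclm k).aestronglyMeasurable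
      (Filter.Eventually.of_forall fun t => ?_)
    rw [Real.norm_eq_abs, abs_of_nonneg ((hk1 k).1.le.trans (hcllow k t))]
    exact hclup k t
  have hlim : ∀ i, Filter.Tendsto (fun k => ∫ t, cl k t * a i t ∂μ) Filter.atTop
      (nhds (∫ t, r t * a i t ∂μ)) := by
    intro i
    refine tendsto_integral_of_dominated_convergence (fun t => |r t * a i t| + |a i t|)
      (fun k => (hcla k i).1) ((hra i).abs.add (hai i).abs) ?_ ?_
    · intro k
      refine Filter.Eventually.of_forall fun t => ?_
      rw [Real.norm_eq_abs, abs_mul, abs_mul]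
      nlinarith [hclb k t, abs_nonneg (a i t)]
    · filter_upwards [hr, hρ0] with t ht h0
      have h0 : 0 ≤ r t := ht ▸ h0
      refine Filter.Tendsto.mul_const _ ?_
      have h1 : Filter.Tendsto (fun k : ℕ => max (r t) (1 / ((k : ℝ) + 1))) Filter.atTop
          (nhds (r t)) := by
        have := (tendsto_const_nhds (x := r t)).max (tendsto_one_div_add_atTop_nhds_zero_nat (𝕜 := ℝ))
        rwa [max_eq_left h0] at this
      refine h1.congr' ?_
      obtain ⟨j, hj⟩ := exists_nat_gt (r t)
      filter_upwards [Filter.eventually_ge_atTop j] with k hk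
      have hk' : (j : ℝ) ≤ k := by exact_mod_cast hk
      symm
      refine min_eq_left (max_le (by linarith) (by linarith [hk1 k, hk0 k]))
  let c : ℕ → Fin n → ℝ := fun k j => ∫ t, r t * a j t ∂μ - ∫ t, cl k t * a j t ∂μ
  have hc0 : Filter.Tendsto (fun k => ∑ j, |c k j| * C j) Filter.atTop (nhds 0) := by
    have : Filter.Tendsto (fun k => ∑ j, |c k j| * C j) Filter.atTop
        (nhds (∑ j : Fin n, |(0 : ℝ)| * C j)) := by
      refine tendsto_finsetSum _ fun j _ => ?_
      refine Filter.Tendsto.mul_const _ (Filter.Tendsto.abs ?_)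
      have := (tendsto_const_nhds (x := ∫ t, r t * a j t ∂μ)).sub (hlim j)
      rwa [sub_self] at this
    simpa using this
  obtain ⟨k, hkm, hkc⟩ : ∃ k, m ≤ k ∧ ∑ j, |c k j| * C j < 1 / ((m : ℝ) + 1) / 2 := by
    have := (hc0.eventually (gt_mem_nhds (half_pos (hk1 m).1))).and
      (Filter.eventually_ge_atTop m)
    obtain ⟨k, h1, h2⟩ := this.exists
    exact ⟨k, h2, h1⟩
  have hw : ∀ t, |∑ j, c k j * z j t| < 1 / ((m : ℝ) + 1) / 2 := by
    intro t
    refine lt_of_le_of_lt ((Finset.abs_sum_le_sum_abs _ _).trans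
      (Finset.sum_le_sum fun j _ => ?_)) hkc
    rw [abs_mul]
    exact mul_le_mul_of_nonneg_left (hC j t) (abs_nonneg _)
  have hwm : Measurable (fun t => ∑ j, c k j * z j t) :=
    Finset.measurable_fun_sum _ fun j _ => (hzm j).const_mul _
  refine ⟨fun t => cl k t + ∑ j, c k j * z j t,
    min (1 / ((m : ℝ) + 1) / 2) (1 / ((k : ℝ) + 1)), ?_, ?_, ?_, ?_⟩
  · exact lt_min (half_pos (hk1 m).1) (hk1 k).1
  · refine memLp_top_of_bound ((hclm k).add hwm).aestronglyMeasurable (k + 1 + 1)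
      (Filter.Eventually.of_forall fun t => ?_)
    have := abs_lt.mp (hw t)
    rw [Real.norm_eq_abs, abs_le]
    constructor <;> linarith [hclup k t, hcllow k t, hk1 k, hk1 m, hk0 k]
  · refine Filter.Eventually.of_forall fun t => ?_
    by_cases ht : t ∈ S
    · refine (min_le_left _ _).trans ?_
      have h1 : 1 / ((m : ℝ) + 1) ≤ cl k t := by
        have hk' : (m : ℝ) ≤ k := by exact_mod_cast hkm
        exact le_min (ht.1.trans (le_max_left _ _)) (by linarith [hk1 m, hk0 k])
      have := abs_lt.mp (hw t)
      linarith
    · refine (min_le_right _ _).trans ?_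
      have : ∑ j, c k j * z j t = 0 :=
        Finset.sum_eq_zero fun j _ => by rw [hzS j t ht, mul_zero]
      beta_reduce
      rw [this, add_zero]
      exact hcllow k t
  · intro i
    have hzi : ∀ j, Integrable (fun t => z j t * a i t) μ := fun j =>
      (hai i).bdd_mul (hzm j).aestronglyMeasurable (Filter.Eventually.of_forall (hC j))
    have hzi' : ∀ j, Integrable (fun t => c k j * (z j t * a i t)) μ := fun j =>
      (hzi j).const_mul _
    rw [heq]
    have h1 : ∀ t, (cl k t + ∑ j, c k j * z j t) * a i t
        = cl k t * a i t + ∑ j, c k j * (z j t * a i t) := by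
      intro t
      rw [add_mul, Finset.sum_mul]
      simp only [mul_assoc]
    simp_rw [h1]
    rw [integral_add (hcla k i) (integrable_finsetSum _ fun j _ => hzi' j),
      integral_finsetSum _ fun j _ => hzi' j]
    simp_rw [integral_const_mul, hzv]
    simp [Pi.single_apply, c]
end
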